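/- arXiv:2507.20429 — 3 statements merged into one kernel-verified Lean document; each statement's English description precedes it below -/
import Mathlib

section
/- Let p be an odd prime and let s, N be integers with 1 < s ≤ N. Then the p-adic norm of the binomial coefficient C(N,s) satisfies |C(N,s)|_p < |N|_p · p^{2(s−1)/(p−1)} (a strict inequality of real numbers, with a real exponent 2(s−1)/(p−1)). Equivalently, (p−1)·v_p(C(N,s)) + 2(s−1) > (p−1)·v_p(N). -/
theorem padicValNat_mul_sub_one_le (p : ℕ) [Fact p.Prime] (s : ℕ) (hs : s ≠ 0) :
    (padicValNat p s : ℝ) * ((p : ℝ) - 1) ≤ (s : ℝ) - 1 := by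
  have hle : p ^ padicValNat p s ≤ s := Nat.le_of_dvd (Nat.pos_of_ne_zero hs) pow_padicValNat_dvd
  have hle' : (p : ℝ) ^ padicValNat p s ≤ s := by exact_mod_cast hle
  have hp0 : (0 : ℝ) ≤ p := Nat.cast_nonneg p
  have hbern := one_add_mul_le_pow (a := (p : ℝ) - 1) (by linarith) (padicValNat p s)
  rw [add_sub_cancel] at hbern
  linarith

theorem Padic.norm_choose_mul_norm_le (p : ℕ) [Fact p.Prime] (N s : ℕ) (hs : s ≠ 0) :
    ‖(N.choose s : ℚ_[p])‖ * ‖(s : ℚ_[p])‖ ≤ ‖(N : ℚ_[p])‖ := by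
  obtain ⟨s, rfl⟩ := Nat.exists_eq_succ_of_ne_zero hs
  cases N with
  | zero => simp
  | succ n =>
    rw [← norm_mul, ← Nat.cast_mul, ← Nat.add_one_mul_choose_eq, Nat.cast_mul, norm_mul]
    exact mul_le_of_le_one_right (norm_nonneg _) (Padic.norm_int_le_one (n.choose s : ℤ))

/-- For an odd prime `p` and integers `1 < s ≤ N`, the `p`-adic norm of the binomial
coefficient satisfies `|C(N,s)|_p < |N|_p · p^(2(s-1)/(p-1))`. -/
theorem stmt2 (p : ℕ) [hpfact : Fact p.Prime] (hp : Odd p)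
    (s N : ℕ) (hs : 1 < s) (hsN : s ≤ N) :
    ‖(N.choose s : ℚ_[p])‖
      < ‖(N : ℚ_[p])‖ * (p : ℝ) ^ ((2 * ((s : ℝ) - 1)) / ((p : ℝ) - 1)) := by
  have hs0 : s ≠ 0 := by omega
  have hp1 : (1 : ℝ) < p := by exact_mod_cast hpfact.out.one_lt
  have hs1 : (1 : ℝ) < s := by exact_mod_cast hs
  have hN : 0 < ‖(N : ℚ_[p])‖ := norm_pos_iff.2 (Nat.cast_ne_zero.2 (by omega))
  have hsnorm : ‖(s : ℚ_[p])‖ = ((p : ℝ) ^ (padicValNat p s : ℝ))⁻¹ := by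
    rw [Padic.norm_eq_zpow_neg_valuation (Nat.cast_ne_zero.2 hs0), Padic.valuation_natCast,
      zpow_neg, zpow_natCast, Real.rpow_natCast]
  have hle := Padic.norm_choose_mul_norm_le p N s hs0
  rw [hsnorm, ← div_eq_mul_inv, div_le_iff₀ (by positivity)] at hle
  refine hle.trans_lt (mul_lt_mul_of_pos_left (Real.rpow_lt_rpow_of_exponent_lt hp1 ?_) hN)
  rw [lt_div_iff₀ (by linarith)]
  linarith [padicValNat_mul_sub_one_le p s hs0]
end

section
/- Let p be an odd prime and let s, N be integers with 1 < s ≤ N, and suppose 2(s−1) ≤ (p−1)·v_p(N). Then the p-adic valuation of the falling factorial N(N−1)(N−2)⋯(N−s+1) satisfies (p−1)·v_p(N(N−1)⋯(N−s+1)) + Σ_{s−1} = (p−1)·v_p(N) + (s−1), where Σ_{s−1} is the sum of the base-p digits of s−1. (Intermediate claim in the proof of Lemma 2.1(ii).) -/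
theorem padicValNat_sub_eq_of_lt_pow {p N j : ℕ} [Fact p.Prime] (hj : 0 < j)
    (hjv : j < p ^ padicValNat p N) (hjN : j < N) :
    padicValNat p (N - j) = padicValNat p j := by
  have hsub : N - j ≠ 0 := by lia
  have hndvd : ¬ p ^ padicValNat p N ∣ j := Nat.not_dvd_of_pos_of_lt hj hjv
  have hdvd : ∀ k ≤ padicValNat p N, (p ^ k ∣ N - j ↔ p ^ k ∣ j) := fun k hk =>
    Nat.dvd_sub_iff_right hjN.le ((pow_dvd_pow p hk).trans pow_padicValNat_dvd)
  have hlt : padicValNat p j < padicValNat p N := by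
    rwa [padicValNat_dvd_iff_le hj.ne', not_le] at hndvd
  have hlt' : padicValNat p (N - j) < padicValNat p N := by
    rwa [← hdvd _ le_rfl, padicValNat_dvd_iff_le hsub, not_le] at hndvd
  apply le_antisymm
  · exact (padicValNat_dvd_iff_le hj.ne').mp ((hdvd _ hlt'.le).mp pow_padicValNat_dvd)
  · exact (padicValNat_dvd_iff_le hsub).mp ((hdvd _ hlt.le).mpr pow_padicValNat_dvd)

theorem padicValNat_prod_sub_succ_eq_factorial {p N t : ℕ} [Fact p.Prime]
    (htv : t < p ^ padicValNat p N) (htN : t < N) :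
    padicValNat p (∏ j ∈ Finset.range t, (N - (j + 1))) = padicValNat p t.factorial := by
  induction t with
  | zero => simp
  | succ t ih =>
    have hprod : ∏ j ∈ Finset.range t, (N - (j + 1)) ≠ 0 :=
      Finset.prod_ne_zero_iff.mpr fun j hj => by
        have := Finset.mem_range.mp hj
        lia
    rw [Finset.prod_range_succ, padicValNat.mul hprod (by lia), Nat.factorial_succ,
      padicValNat.mul t.succ_ne_zero t.factorial_ne_zero, ih (by lia) (by lia),
      padicValNat_sub_eq_of_lt_pow t.succ_pos htv htN, add_comm]

theorem sub_one_mul_lt_pow {p : ℕ} (hp : 0 < p) (v : ℕ) : (p - 1) * v < p ^ v := by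
  obtain ⟨q, rfl⟩ : ∃ q, p = q + 1 := ⟨p - 1, by lia⟩
  rw [Nat.add_sub_cancel]
  induction v with
  | zero => simp
  | succ v ih =>
    have := Nat.one_le_pow v (q + 1) q.succ_pos
    rw [pow_succ]
    nlinarith


/-- Intermediate claim in the proof of Lemma 2.1(ii): for an odd prime `p` and
`1 < s ≤ N` with `2(s-1) ≤ (p-1)·v_p(N)`, the `p`-adic valuation of the falling factorial
`N(N-1)⋯(N-s+1)` satisfies
`(p-1)·v_p(N(N-1)⋯(N-s+1)) + Σ_(s-1) = (p-1)·v_p(N) + (s-1)`,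
where `Σ_(s-1)` is the sum of the base-`p` digits of `s-1`. -/
theorem stmt3 (p : ℕ) [hpfact : Fact p.Prime] (hp : Odd p)
    (s N : ℕ) (hs : 1 < s) (hsN : s ≤ N)
    (hval : 2 * (s - 1) ≤ (p - 1) * padicValNat p N) :
    (p - 1) * padicValNat p (∏ j ∈ Finset.range s, (N - j)) + (Nat.digits p (s - 1)).sum
      = (p - 1) * padicValNat p N + (s - 1) := by
  obtain ⟨t, rfl⟩ : ∃ t, s = t + 1 := ⟨s - 1, by lia⟩
  rw [Nat.add_sub_cancel] at hval ⊢
  have htv : t < p ^ padicValNat p N := by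
    have := sub_one_mul_lt_pow hpfact.out.pos (padicValNat p N)
    lia
  have hprod : ∏ j ∈ Finset.range t, (N - (j + 1)) ≠ 0 :=
    Finset.prod_ne_zero_iff.mpr fun j hj => by
      have := Finset.mem_range.mp hj
      lia
  rw [Finset.prod_range_succ', padicValNat.mul hprod (by lia),
    padicValNat_prod_sub_succ_eq_factorial htv (by lia), Nat.sub_zero, mul_add,
    sub_one_mul_padicValNat_factorial]
  have := Nat.digit_sum_le p t
  lia
end

section
/- Let π₃ = √3·i ∈ ℂ, so that π₃² = −3. In ℂ⟦z⟧ define: E(z) = exp(π₃z) = Σ_{n≥0} (π₃ⁿ/n!)·zⁿ; B(z) = J₀(π₃z) = Σ_{n≥0} (3ⁿ/(4ⁿ·(n!)²))·z^{2n}; 𝔄(z) = Σ_{n≥0} (Σ_{k=0}^{n} C(n,k)²·C(n+k,k)²)·zⁿ; and 𝔣(z) = Σ_{n≥0} (−C(2n,n)³/((2n−1)·64ⁿ))·zⁿ. Then for all natural numbers r, s, k, the five power series z, E(z), B^{(r)}(z), 𝔄^{(s)}(z), 𝔣^{(k)}(z) are algebraically independent over ℚ, where ^{(r)} denotes the r-fold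 formal derivative; equivalently, E(z), B^{(r)}(z), 𝔄^{(s)}(z), 𝔣^{(k)}(z) are algebraically independent over ℚ(z). (Corollary 6.3.) -/
/-- The Apéry numbers `∑ⱼ C(n,j)² C(n+j,j)²`. -/
def aperyNumber (n : ℕ) : ℕ :=
  ∑ j ∈ Finset.range (n + 1), n.choose j ^ 2 * (n + j).choose j ^ 2

theorem aperyNumber_eq_sum {n N : ℕ} (h : n + 1 ≤ N) :
    aperyNumber n = ∑ j ∈ Finset.range N, n.choose j ^ 2 * (n + j).choose j ^ 2 := by
  unfold aperyNumber
  refine Finset.sum_subset (by simpa using h) fun j _ hj => ?_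
  rw [Nat.choose_eq_zero_of_lt (by simpa using hj)]
  simp

theorem apery_term_succ_right (n k : ℕ) :
    ((k : ℚ) + 1) ^ 2 * (n.choose (k + 1) * (n + (k + 1)).choose (k + 1))
      = (n - k) * (n + k + 1) * (n.choose k * (n + k).choose k) := by
  have h1 : ((n.choose (k + 1) : ℕ) : ℚ) * (k + 1) = n.choose k * (n - k) := by
    rcases le_or_gt k n with h | h
    · have := Nat.choose_succ_right_eq n k
      rw [← Nat.cast_sub h]
      exact_mod_cast this
    · rw [Nat.choose_eq_zero_of_lt h, Nat.choose_eq_zero_of_lt (by omega)]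
      simp
  have h2 : ((n + k + 1 : ℕ) : ℚ) * (n + k).choose k = (n + k + 1).choose (k + 1) * (k + 1) := by
    exact_mod_cast Nat.add_one_mul_choose_eq (n + k) k
  push_cast at h2
  rw [← add_assoc]
  linear_combination (k + 1 : ℚ) * ((n + k + 1).choose (k + 1) : ℚ) * h1 - (n.choose k : ℚ) * (n - k : ℚ) * h2

theorem apery_term_succ_left (n k : ℕ) :
    ((n : ℚ) + 1 - k) * ((n + 1).choose k * (n + 1 + k).choose k)
      = (n + 1 + k) * (n.choose k * (n + k).choose k) := by
  have h1 : ((n + 1).choose k : ℚ) * (n + 1 - k) = (n + 1) * n.choose k := by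
    rcases le_or_gt k (n + 1) with h | h
    · have := Nat.choose_mul_succ_eq n k
      have h' : ((n + 1 - k : ℕ) : ℚ) = n + 1 - k := by push_cast [Nat.cast_sub h]; ring
      rw [← h', mul_comm ((n : ℚ) + 1)]
      exact_mod_cast this.symm
    · rw [Nat.choose_eq_zero_of_lt h, Nat.choose_eq_zero_of_lt (by omega)]
      simp
  have h2 : ((n + 1 + k).choose k : ℚ) * (n + 1) = (n + 1 + k) * (n + k).choose k := by
    have := Nat.choose_mul_succ_eq (n + k) k
    rw [show n + k + 1 - k = n + 1 by omega, show n + k + 1 = n + 1 + k by omega] at this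
    rw [mul_comm ((n : ℚ) + 1 + k)]
    exact_mod_cast this.symm
  have h3 : (n : ℚ) + 1 ≠ 0 := by positivity
  apply mul_left_cancel₀ h3
  linear_combination (n + 1 : ℚ) * ((n + 1 + k).choose k : ℚ) * h1 + (n + 1) * (n.choose k : ℚ) * h2

theorem apery_term_succ_succ (n k : ℕ) :
    ((k : ℚ) + 1) ^ 2 * ((n + 1).choose (k + 1) * (n + 1 + (k + 1)).choose (k + 1))
      = (n + 1 + k) * (n + 2 + k) * (n.choose k * (n + k).choose k) := by
  have h1 := apery_term_succ_right (n + 1) k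
  have h2 := apery_term_succ_left n k
  push_cast at h1 h2 ⊢
  linear_combination h1 + (n + k + 2) * h2

theorem apery_telescoping (n N : ℕ) :
    ∑ k ∈ Finset.range (N + 1),
      (((n : ℚ) + 2) ^ 3 * ((n + 2).choose k * (n + 2 + k).choose k) ^ 2
        - (34 * (n + 1) ^ 3 + 51 * (n + 1) ^ 2 + 27 * (n + 1) + 5)
          * ((n + 1).choose k * (n + 1 + k).choose k) ^ 2
        + (n + 1) ^ 3 * (n.choose k * (n + k).choose k) ^ 2)
      = 4 * (2 * (n : ℚ) + 3) * ((N : ℚ) * (2 * N + 1) - (2 * n + 3) ^ 2)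
        * (((n + 1).choose N : ℚ) * ((n + 1 + N).choose N : ℚ)) ^ 2 := by
  induction N with
  | zero => simp; ring
  | succ k ih =>
    rw [Finset.sum_range_succ, ih]
    have h1 := apery_term_succ_succ (n + 1) k
    have h2 := apery_term_succ_right (n + 1) k
    have h3 := apery_term_succ_right n k
    have h4 := apery_term_succ_left n k
    rw [show n + 1 + 1 = n + 2 from rfl] at h1
    push_cast at h1 h2 h3 h4 ⊢
    generalize ((n + 2).choose (k + 1) : ℚ) * ((n + 2 + (k + 1)).choose (k + 1) : ℚ) = a at *
    generalize ((n + 1).choose (k + 1) : ℚ) * ((n + 1 + (k + 1)).choose (k + 1) : ℚ) = b at *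
    generalize (n.choose (k + 1) : ℚ) * ((n + (k + 1)).choose (k + 1) : ℚ) = c at *
    generalize ((n + 1).choose k : ℚ) * ((n + 1 + k).choose k : ℚ) = d at *
    generalize (n.choose k : ℚ) * ((n + k).choose k : ℚ) = e at *
    have h5 : ((k : ℚ) + 1) ^ 2 * c = (n - k) * (n + 1 - k) * d := by
      linear_combination h3 - (n - k : ℚ) * h4
    have hk : (k : ℚ) + 1 ≠ 0 := by positivity
    have ea : a = (n + 1 + 1 + k) * (n + 1 + 2 + k) * d / ((k : ℚ) + 1) ^ 2 := by
      field_simp; linear_combination h1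
    have eb : b = (n + 1 - k) * (n + 1 + k + 1) * d / ((k : ℚ) + 1) ^ 2 := by
      field_simp; linear_combination h2
    have ec : c = (n - k) * (n + 1 - k) * d / ((k : ℚ) + 1) ^ 2 := by
      field_simp; linear_combination h5
    rw [ea, eb, ec]
    field_simp
    ring

theorem aperyNumber_recurrence (n : ℕ) :
    ((n : ℤ) + 2) ^ 3 * aperyNumber (n + 2)
      = (34 * (n + 1) ^ 3 + 51 * (n + 1) ^ 2 + 27 * (n + 1) + 5) * aperyNumber (n + 1)
        - (n + 1) ^ 3 * aperyNumber n := by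
  have h := apery_telescoping n (n + 2)
  rw [Finset.sum_add_distrib, Finset.sum_sub_distrib, ← Finset.mul_sum, ← Finset.mul_sum,
    ← Finset.mul_sum, Nat.choose_eq_zero_of_lt (show n + 1 < n + 2 by omega)] at h
  have e : ∀ m, m + 1 ≤ n + 2 + 1 → ∑ k ∈ Finset.range (n + 2 + 1),
      ((m.choose k : ℚ) * ((m + k).choose k : ℚ)) ^ 2 = aperyNumber m := fun m hm => by
    rw [aperyNumber_eq_sum hm]
    push_cast
    exact Finset.sum_congr rfl fun _ _ => mul_pow _ _ _
  rw [e _ le_rfl, e _ (by omega), e _ (by omega)] at h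
  have : ((n : ℚ) + 2) ^ 3 * aperyNumber (n + 2)
      = (34 * (n + 1) ^ 3 + 51 * (n + 1) ^ 2 + 27 * (n + 1) + 5) * aperyNumber (n + 1)
        - (n + 1) ^ 3 * aperyNumber n := by
    simp at h
    linear_combination h
  exact_mod_cast this

theorem sum_range_mul_eq {M : Type*} [AddCommMonoid M] (F : ℕ → M) (p m : ℕ) :
    ∑ k ∈ Finset.range (p * m), F k
      = ∑ i ∈ Finset.range m, ∑ j ∈ Finset.range p, F (j + p * i) := by
  induction m with
  | zero => simp
  | succ m ih =>
    rw [Nat.mul_succ, Finset.sum_range_add, ih, Finset.sum_range_succ]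
    simp only [add_comm]

section Lucas

variable {p : ℕ} [Fact p.Prime]

theorem choose_zmod {n₀ k₀ : ℕ} (hn : n₀ < p) (hk : k₀ < p) (n₁ k₁ : ℕ) :
    ((n₀ + p * n₁).choose (k₀ + p * k₁) : ZMod p) = n₀.choose k₀ * n₁.choose k₁ := by
  have hp : 0 < p := (Fact.out : p.Prime).pos
  have h := (ZMod.natCast_eq_natCast_iff _ _ _).2
    (Choose.choose_modEq_choose_mod_mul_choose_div_nat (p := p) (n := n₀ + p * n₁)
      (k := k₀ + p * k₁))
  rw [Nat.add_mul_mod_self_left, Nat.add_mul_mod_self_left, Nat.add_mul_div_left _ _ hp,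
    Nat.add_mul_div_left _ _ hp, Nat.mod_eq_of_lt hn, Nat.mod_eq_of_lt hk,
    Nat.div_eq_of_lt hn, Nat.div_eq_of_lt hk] at h
  simpa using h

theorem choose_add_zmod {n₀ k₀ : ℕ} (hn : n₀ < p) (hk : k₀ < p) (n₁ k₁ : ℕ) :
    ((n₀ + p * n₁ + (k₀ + p * k₁)).choose (k₀ + p * k₁) : ZMod p)
      = (n₀ + k₀).choose k₀ * (n₁ + k₁).choose k₁ := by
  rcases lt_or_ge (n₀ + k₀) p with h | h
  · rw [show n₀ + p * n₁ + (k₀ + p * k₁) = n₀ + k₀ + p * (n₁ + k₁) by ring, choose_zmod h hk]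
  · obtain ⟨c, hc⟩ := Nat.exists_eq_add_of_le h
    have e1 : n₀ + p * n₁ + (k₀ + p * k₁) = c + p * (n₁ + k₁ + 1) := by
      rw [show n₀ + p * n₁ + (k₀ + p * k₁) = n₀ + k₀ + p * (n₁ + k₁) by ring, hc]; ring
    have e2 : n₀ + k₀ = c + p * 1 := by omega
    have e3 := choose_zmod (show c < p by omega) hk 1 0
    rw [mul_zero, add_zero] at e3
    rw [e1, choose_zmod (by omega) hk, e2, e3, Nat.choose_eq_zero_of_lt (show c < k₀ by omega)]
    simp

theorem aperyNumber_zmod {n₀ : ℕ} (hn : n₀ < p) (n₁ : ℕ) :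
    (aperyNumber (n₀ + p * n₁) : ZMod p) = aperyNumber n₀ * aperyNumber n₁ := by
  rw [aperyNumber_eq_sum (N := p * (n₁ + 1)) (by rw [mul_add]; omega), sum_range_mul_eq,
    aperyNumber_eq_sum (N := p) hn, aperyNumber]
  push_cast
  rw [Finset.sum_mul_sum, Finset.sum_comm]
  refine Finset.sum_congr rfl fun k₀ hk => Finset.sum_congr rfl fun k₁ _ => ?_
  have hk := Finset.mem_range.1 hk
  rw [choose_zmod hn hk, choose_add_zmod hn hk]
  ring

theorem centralBinom_zmod {n₀ : ℕ} (hn : n₀ < p) (n₁ : ℕ) :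
    ((n₀ + p * n₁).centralBinom : ZMod p) = n₀.centralBinom * n₁.centralBinom := by
  have h := choose_add_zmod hn hn n₁ n₁
  simpa only [Nat.centralBinom_eq_two_mul_choose, two_mul] using h

end Lucas

/-- The integers `C(2n,n) / (2n - 1)`. -/
def centralBinomQuotient : ℕ → ℤ
  | 0 => -1
  | n + 1 => 4 * n.centralBinom - (n + 1).centralBinom

theorem centralBinomQuotient_mul (n : ℕ) :
    (2 * (n : ℤ) - 1) * centralBinomQuotient n = n.centralBinom := by
  rcases n with _ | n
  · simp [centralBinomQuotient]
  · have h : ((n : ℤ) + 1) * (n + 1).centralBinom = 2 * (2 * n + 1) * n.centralBinom := by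
      exact_mod_cast Nat.succ_mul_centralBinom_succ n
    simp only [centralBinomQuotient]
    push_cast
    linear_combination (-2) * h

section Lucas

variable {p : ℕ} [Fact p.Prime]

theorem centralBinom_mul_centralBinomQuotient_zmod {n₀ : ℕ} (hn : n₀ < p) (n₁ : ℕ) :
    ((n₀ + p * n₁).centralBinom : ZMod p) * centralBinomQuotient (n₀ + p * n₁)
      = n₀.centralBinom * centralBinomQuotient n₀ * n₁.centralBinom ^ 2 := by
  have h0 : (2 * (n₀ : ZMod p) - 1) * centralBinomQuotient n₀ = n₀.centralBinom := by
    exact_mod_cast congrArg (Int.cast : ℤ → ZMod p) (centralBinomQuotient_mul n₀)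
  have h1 : (2 * (n₀ : ZMod p) - 1) * centralBinomQuotient (n₀ + p * n₁)
      = (n₀ + p * n₁).centralBinom := by
    have := congrArg (Int.cast : ℤ → ZMod p) (centralBinomQuotient_mul (n₀ + p * n₁))
    push_cast at this
    rw [← this]
    simp
  rw [centralBinom_zmod hn] at h1 ⊢
  by_cases h : 2 * (n₀ : ZMod p) - 1 = 0
  · rw [h, zero_mul] at h0
    rw [← h0]
    simp
  · have : (centralBinomQuotient (n₀ + p * n₁) : ZMod p)
        = centralBinomQuotient n₀ * n₁.centralBinom := by
      apply mul_left_cancel₀ h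
      rw [h1, ← h0]; ring
    rw [this]; ring

theorem sixtyFour_pow_zmod (n₀ n₁ : ℕ) : (64 : ZMod p) ^ (n₀ + p * n₁) = 64 ^ n₀ * 64 ^ n₁ := by
  rw [pow_add, pow_mul, ZMod.pow_card]

open PowerSeries in
theorem mk_eq_trunc_mul_pow {a b c : ℕ → ZMod p}
    (h : ∀ n₀ < p, ∀ n₁, a (n₀ + p * n₁) = c n₀ * b n₁) :
    mk a = (trunc p (mk c) : PowerSeries (ZMod p)) * mk b ^ p := by
  have hp : p ≠ 0 := (Fact.out : p.Prime).ne_zero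
  have hb : mk b ^ p = (mk b).expand p hp := by
    have h := MvPowerSeries.map_frobenius_expand p hp (f := mk b)
    rw [ZMod.frobenius_zmod, MvPowerSeries.map_id] at h
    exact h.symm
  rw [hb]
  ext n
  rw [coeff_mul, coeff_mk, Finset.sum_eq_single (n % p, n - n % p)]
  · have h1 : n - n % p = p * (n / p) := by
      have := Nat.mod_add_div n p; omega
    dsimp only
    rw [h1, coeff_expand_mul, Polynomial.coeff_coe, coeff_trunc,
      if_pos (Nat.mod_lt _ (Nat.pos_of_ne_zero hp)), coeff_mk, coeff_mk,
      ← h _ (Nat.mod_lt _ (Nat.pos_of_ne_zero hp)), Nat.mod_add_div]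
  · rintro ⟨i, j⟩ hij hne
    have hij := Finset.HasAntidiagonal.mem_antidiagonal.1 hij
    dsimp only at hij ⊢
    by_cases hj : p ∣ j
    · obtain ⟨m, rfl⟩ := hj
      have hi : ¬ i < p := fun hi => hne (by
        rw [← hij]
        rw [Nat.add_mul_mod_self_left, Nat.mod_eq_of_lt hi]
        simp)
      rw [Polynomial.coeff_coe, coeff_trunc, if_neg hi, zero_mul]
    · rw [coeff_expand_of_not_dvd _ hp _ hj, mul_zero]
  · intro hn
    exact absurd (Finset.HasAntidiagonal.mem_antidiagonal.2 (Nat.add_sub_cancel' (Nat.mod_le _ _))) hn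

end Lucas

open Polynomial in
theorem prime_dvd_leadingCoeff_of_ode {K : Type*} [Field K] {q u y p₃ p₂ p₁ p₀ : K[X]} {j : ℕ}
    (hq : Prime q) (hq' : ¬ q ∣ derivative q) (hu : ¬ q ∣ u)
    (hj : ∀ i, 1 ≤ i → i ≤ j + 3 → (i : K) ≠ 0) (hy : y = q ^ (j + 3) * u)
    (h : p₃ * derivative (derivative (derivative y)) + p₂ * derivative (derivative y)
      + p₁ * derivative y + p₀ * y = 0) : q ∣ p₃ := by
  have hc : ∀ i : ℕ, 1 ≤ i → i ≤ j + 3 → ¬ q ∣ (i : K[X]) := fun i h1 h2 hd =>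
    hq.not_isUnit (isUnit_of_dvd_unit hd (by
      rw [← map_natCast (C : K →+* K[X])]; exact (isUnit_C.2 (hj i h1 h2).isUnit)))
  set u₁ := ((j + 3 : ℕ) : K[X]) * derivative q * u + q * derivative u with hu₁
  set u₂ := ((j + 2 : ℕ) : K[X]) * derivative q * u₁ + q * derivative u₁ with hu₂
  set u₃ := ((j + 1 : ℕ) : K[X]) * derivative q * u₂ + q * derivative u₂ with hu₃
  have step : ∀ (n : ℕ) (v : K[X]), derivative (q ^ (n + 1) * v)
      = q ^ n * (((n + 1 : ℕ) : K[X]) * derivative q * v + q * derivative v) := by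
    intro n v
    rw [derivative_mul, derivative_pow]
    simp only [Nat.add_sub_cancel, map_natCast]
    ring
  have d1 : derivative y = q ^ (j + 2) * u₁ := by rw [hy, step]
  have d2 : derivative (derivative y) = q ^ (j + 1) * u₂ := by rw [d1, step]
  have d3 : derivative (derivative (derivative y)) = q ^ j * u₃ := by rw [d2, step]
  rw [d3, d2, d1, hy] at h
  have h' : p₃ * u₃ = q * (-(p₂ * u₂ + p₁ * q * u₁ + p₀ * q ^ 2 * u)) := by
    apply mul_left_cancel₀ (pow_ne_zero j hq.ne_zero)
    linear_combination h
  have key : ∀ (n : ℕ) (v : K[X]), 1 ≤ n → n ≤ j + 3 → ¬ q ∣ v →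
      ¬ q ∣ ((n : K[X]) * derivative q * v + q * derivative v) := by
    intro n v h1 h2 hv hd
    rcases hq.dvd_or_dvd ((dvd_add_left (dvd_mul_right q _)).1 hd) with hd | hd
    · rcases hq.dvd_or_dvd hd with hd | hd
      · exact hc n h1 h2 hd
      · exact hq' hd
    · exact hv hd
  refine (hq.dvd_or_dvd (Dvd.intro _ h'.symm)).resolve_right ?_
  exact key _ _ (by omega) (by omega) (key _ _ (by omega) (by omega)
    (key _ _ (by omega) (by omega) hu))

open Polynomial in
theorem prime_dvd_indicial_of_ode {K : Type*} [Field K] {q u y r p₂ p₁ p₀ : K[X]} {j : ℕ}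
    (hq : Prime q) (hq' : ¬ q ∣ derivative q) (hu : ¬ q ∣ u)
    (hj : ∀ i, 1 ≤ i → i ≤ j + 2 → (i : K) ≠ 0) (hy : y = q ^ (j + 2) * u)
    (h : q * r * derivative (derivative (derivative y)) + p₂ * derivative (derivative y)
      + p₁ * derivative y + p₀ * y = 0) : q ∣ (j : K[X]) * r * derivative q + p₂ := by
  have hc : ∀ i : ℕ, 1 ≤ i → i ≤ j + 2 → ¬ q ∣ (i : K[X]) := fun i h1 h2 hd =>
    hq.not_isUnit (isUnit_of_dvd_unit hd (by
      rw [← map_natCast (C : K →+* K[X])]; exact (isUnit_C.2 (hj i h1 h2).isUnit)))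
  set u₁ := ((j + 2 : ℕ) : K[X]) * derivative q * u + q * derivative u with hu₁
  set u₂ := ((j + 1 : ℕ) : K[X]) * derivative q * u₁ + q * derivative u₁ with hu₂
  have step : ∀ (n : ℕ) (v : K[X]), derivative (q ^ (n + 1) * v)
      = q ^ n * (((n + 1 : ℕ) : K[X]) * derivative q * v + q * derivative v) := by
    intro n v
    rw [derivative_mul, derivative_pow]
    simp only [Nat.add_sub_cancel, map_natCast]
    ring
  have d1 : derivative y = q ^ (j + 1) * u₁ := by rw [hy, step]
  have d2 : derivative (derivative y) = q ^ j * u₂ := by rw [d1, step]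
  have d3 : q * derivative (derivative (derivative y))
      = q ^ j * ((j : K[X]) * derivative q * u₂ + q * derivative u₂) := by
    rw [d2]
    rcases j with _ | j
    · simp
    · rw [step]; ring
  have h' : ((j : K[X]) * r * derivative q + p₂) * u₂
      = q * (-(r * derivative u₂ + p₁ * u₁ + p₀ * q * u)) := by
    apply mul_left_cancel₀ (pow_ne_zero j hq.ne_zero)
    rw [d2, d1, hy] at h
    rw [d2] at d3
    linear_combination h - r * d3
  have key : ∀ (n : ℕ) (v : K[X]), 1 ≤ n → n ≤ j + 2 → ¬ q ∣ v →
      ¬ q ∣ ((n : K[X]) * derivative q * v + q * derivative v) := by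
    intro n v h1 h2 hv hd
    rcases hq.dvd_or_dvd ((dvd_add_left (dvd_mul_right q _)).1 hd) with hd | hd
    · rcases hq.dvd_or_dvd hd with hd | hd
      · exact hc n h1 h2 hd
      · exact hq' hd
    · exact hv hd
  refine (hq.dvd_or_dvd (Dvd.intro _ h'.symm)).resolve_right ?_
  exact key _ _ (by omega) (by omega) (key _ _ (by omega) (by omega) hu)

open Polynomial in
theorem coeff_X_mul_derivative {K : Type*} [CommRing K] (y : K[X]) (n : ℕ) :
    (X * derivative y).coeff n = n * y.coeff n := by
  rcases n with _ | n
  · simp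
  · rw [coeff_X_mul, coeff_derivative]; push_cast; ring

open Polynomial in
theorem apery_ode {K : Type*} [CommRing K] (y : K[X])
    (h0 : y.coeff 1 = 5 * y.coeff 0)
    (h : ∀ n : ℕ, ((n : K) + 2) ^ 3 * y.coeff (n + 2)
      = (34 * ((n : K) + 1) ^ 3 + 51 * ((n : K) + 1) ^ 2 + 27 * ((n : K) + 1) + 5) * y.coeff (n + 1)
        - ((n : K) + 1) ^ 3 * y.coeff n) :
    (X ^ 3 * (X ^ 2 - 34 * X + 1)) * derivative (derivative (derivative y))
      + (3 * X ^ 2 - 153 * X ^ 3 + 6 * X ^ 4) * derivative (derivative y)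
      + (X - 112 * X ^ 2 + 7 * X ^ 3) * derivative y + (X ^ 2 - 5 * X) * y = 0 := by
  set t₁ := X * derivative y with ht₁
  set t₂ := X * derivative t₁ with ht₂
  set t₃ := X * derivative t₂ with ht₃
  have key : t₃ - X * (34 * t₃ + 51 * t₂ + 27 * t₁ + 5 * y)
      + X * (X * (t₃ + 3 * t₂ + 3 * t₁ + y)) = 0 := by
    have c1 : ∀ n, t₁.coeff n = n * y.coeff n := fun n => coeff_X_mul_derivative y n
    have c2 : ∀ n, t₂.coeff n = n * (n * y.coeff n) := fun n => by
      rw [ht₂, coeff_X_mul_derivative, c1]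
    have c3 : ∀ n, t₃.coeff n = n * (n * (n * y.coeff n)) := fun n => by
      rw [ht₃, coeff_X_mul_derivative, c2]
    have e : ∀ (m : ℕ) (v : K[X]) (n : ℕ), (((m : ℕ) : K[X]) * v).coeff n = m * v.coeff n :=
      fun m v n => by rw [← map_natCast (C : K →+* K[X]), coeff_C_mul]
    have e34 := e 34; have e51 := e 51; have e27 := e 27; have e5 := e 5; have e3 := e 3
    push_cast at e34 e51 e27 e5 e3
    ext n
    rcases n with _ | _ | n
    · simp [c3]
    · simp only [coeff_add, coeff_sub, coeff_X_mul, coeff_X_mul_zero, e34, e51, e27, e5,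
        c1, c2, c3, zero_add, coeff_zero]
      push_cast
      linear_combination h0
    · simp only [coeff_add, coeff_sub, coeff_X_mul, e34, e51, e27, e5, e3, c1, c2, c3, coeff_zero]
      push_cast
      linear_combination h n
  rw [ht₃, ht₂, ht₁] at key
  simp only [derivative_mul, derivative_X, derivative_add, derivative_one] at key
  linear_combination key

open Polynomial in
theorem binomial_ode {K : Type*} [CommRing K] (y : K[X])
    (h : ∀ n : ℕ, 8 * ((n : K) + 1) ^ 3 * y.coeff (n + 1) = (2 * (n : K) + 1) ^ 3 * y.coeff n) :
    ((X - 1) * (-8 * X ^ 3)) * derivative (derivative (derivative y))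
      + (24 * X ^ 2 - 36 * X ^ 3) * derivative (derivative y)
      + (8 * X - 26 * X ^ 2) * derivative y + (- X) * y = 0 := by
  set t₁ := X * derivative y with ht₁
  set t₂ := X * derivative t₁ with ht₂
  set t₃ := X * derivative t₂ with ht₃
  have key : 8 * t₃ - X * (8 * t₃ + 12 * t₂ + 6 * t₁ + y) = 0 := by
    have c1 : ∀ n, t₁.coeff n = n * y.coeff n := fun n => coeff_X_mul_derivative y n
    have c2 : ∀ n, t₂.coeff n = n * (n * y.coeff n) := fun n => by
      rw [ht₂, coeff_X_mul_derivative, c1]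
    have c3 : ∀ n, t₃.coeff n = n * (n * (n * y.coeff n)) := fun n => by
      rw [ht₃, coeff_X_mul_derivative, c2]
    have e : ∀ (m : ℕ) (v : K[X]) (n : ℕ), (((m : ℕ) : K[X]) * v).coeff n = m * v.coeff n :=
      fun m v n => by rw [← map_natCast (C : K →+* K[X]), coeff_C_mul]
    have e8 := e 8; have e12 := e 12; have e6 := e 6
    push_cast at e8 e12 e6
    ext n
    rcases n with _ | n
    · simp [c3, e8]
    · simp only [coeff_add, coeff_sub, coeff_X_mul, e8, e12, e6, c1, c2, c3, coeff_zero]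
      push_cast
      linear_combination h n
  rw [ht₃, ht₂, ht₁] at key
  simp only [derivative_mul, derivative_X, derivative_add, derivative_one] at key
  linear_combination key

theorem natCast_zmod_ne_zero {p i : ℕ} (h1 : 1 ≤ i) (h2 : i < p) : (i : ZMod p) ≠ 0 := by
  rw [Ne, ZMod.natCast_eq_zero_iff]
  exact fun h => absurd (Nat.le_of_dvd h1 h) (by omega)

open Polynomial in
theorem not_dvd_derivative {p : ℕ} [Fact p.Prime] {q : (ZMod p)[X]} (hq : Irreducible q) :
    ¬ q ∣ derivative q := fun h => by
  have := PerfectField.separable_of_irreducible hq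
  exact hq.not_isUnit (this.isUnit_of_dvd' dvd_rfl h)

open Polynomial in
theorem not_dvd_X_of_dvd {K : Type*} [Field K] {q y : K[X]} (hq : Irreducible q) (hqy : q ∣ y)
    (h0 : y.coeff 0 ≠ 0) : ¬ q ∣ X := fun h => by
  have := (hq.associated_of_dvd irreducible_X h).symm.dvd.trans hqy
  exact h0 (X_dvd_iff.1 this)

open Polynomial in
theorem irreducible_apery_quadratic {p : ℕ} [Fact p.Prime] (hp : 3 < p)
    (h2 : ¬ IsSquare (2 : ZMod p)) : Irreducible (X ^ 2 - 34 * X + 1 : (ZMod p)[X]) := by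
  have hdeg : (X ^ 2 - 34 * X + 1 : (ZMod p)[X]).natDegree = 2 := by
    rw [show (X ^ 2 - 34 * X + 1 : (ZMod p)[X]) = X ^ 2 + C (-34) * X + C 1 by
      simp [sub_eq_add_neg, map_ofNat C 34]]
    compute_degree!
  refine irreducible_of_degree_le_three_of_not_isRoot (by rw [hdeg]; simp) fun x hx => h2 ?_
  have hx' : x ^ 2 - 34 * x + 1 = 0 := by simpa using hx
  have h12 : (12 : ZMod p) ≠ 0 := by
    have h2' : (2 : ZMod p) ≠ 0 := by exact_mod_cast natCast_zmod_ne_zero (i := 2) (by omega) (by omega)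
    have h3' : (3 : ZMod p) ≠ 0 := by exact_mod_cast natCast_zmod_ne_zero (i := 3) (by omega) (by omega)
    rw [show (12 : ZMod p) = 2 * 2 * 3 by norm_num]
    exact mul_ne_zero (mul_ne_zero h2' h2') h3'
  refine ⟨(x - 17) / 12, ?_⟩
  field_simp
  linear_combination (-1) * hx'

open Polynomial in
theorem multiplicity_le_two_of_apery {p : ℕ} [Fact p.Prime] (hp : 3 < p)
    (h2 : ¬ IsSquare (2 : ZMod p)) {q y : (ZMod p)[X]} (hq : Irreducible q)
    (hdeg : y.natDegree < p) (h0 : y.coeff 0 ≠ 0) {p₁ p₀ : (ZMod p)[X]}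
    (h : (X ^ 3 * (X ^ 2 - 34 * X + 1)) * derivative (derivative (derivative y))
      + (3 * X ^ 2 - 153 * X ^ 3 + 6 * X ^ 4) * derivative (derivative y)
      + p₁ * derivative y + p₀ * y = 0) : multiplicity q y ≤ 2 := by
  by_contra! hm
  have hy0 : y ≠ 0 := fun h => h0 (by simp [h])
  obtain ⟨u, hu, hqu⟩ := (FiniteMultiplicity.of_not_isUnit hq.not_isUnit hy0).exists_eq_pow_mul_and_not_dvd
  set m := multiplicity q y
  have hqy : q ∣ y := hu ▸ Dvd.dvd.mul_right (dvd_pow_self q (by omega)) u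
  have hu0 : u ≠ 0 := fun h => hqu (h ▸ dvd_zero q)
  have hnd : y.natDegree = m * q.natDegree + u.natDegree := by
    rw [hu, natDegree_mul (pow_ne_zero _ hq.ne_zero) hu0, natDegree_pow]
  have hq1 : 1 ≤ q.natDegree := hq.natDegree_pos
  have hmp : m < p := by nlinarith
  obtain ⟨j, hj⟩ : ∃ j, m = j + 3 := ⟨m - 3, by omega⟩
  have hd := prime_dvd_leadingCoeff_of_ode hq.prime (not_dvd_derivative hq) hqu
    (fun i h1 h2 => natCast_zmod_ne_zero h1 (by omega)) (hj ▸ hu) h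
  have hX := not_dvd_X_of_dvd hq hqy h0
  have hQ := irreducible_apery_quadratic hp h2
  have hqQ := (hq.prime.dvd_or_dvd hd).resolve_left fun h => hX (hq.prime.dvd_of_dvd_pow h)
  have ha := hq.associated_of_dvd hQ hqQ
  obtain ⟨c, hc⟩ := ha.symm
  set Q := (X ^ 2 - 34 * X + 1 : (ZMod p)[X]) with hQdef
  have hQdeg : Q.natDegree = 2 := by
    rw [hQdef, show (X ^ 2 - 34 * X + 1 : (ZMod p)[X]) = X ^ 2 + C (-34) * X + C 1 by
      simp [sub_eq_add_neg, map_ofNat C 34]]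
    compute_degree!
  have hqdeg : q.natDegree = 2 := by rw [natDegree_eq_of_degree_eq (degree_eq_degree_of_associated ha), hQdeg]
  have hu' : y = Q ^ (j + 3) * (↑c ^ m * u) := by
    rw [hu, ← hj, ← mul_assoc, ← mul_pow, hc]
  have hQu : ¬ Q ∣ ↑c ^ m * u := fun hd => hqu (by
    have := ha.dvd.trans hd
    rwa [← Units.val_pow_eq_pow_val, (c ^ m).isUnit.dvd_mul_left] at this)
  have hI := prime_dvd_indicial_of_ode (r := X ^ 3) hQ.prime (not_dvd_derivative hQ) hQu
    (fun i h1 h2 => natCast_zmod_ne_zero h1 (by omega)) hu' (by rw [mul_comm Q]; exact h)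
  have hQ' : derivative Q = 2 * X - 34 := by
    rw [hQdef]; simp [derivative_pow, map_ofNat C 2, ← map_ofNat C 34]
  have hI2 : Q ∣ ((2 * j + 5 : ℕ) : (ZMod p)[X]) * (X ^ 3 * (X - 17)) := by
    rw [hQ'] at hI
    have := dvd_sub hI (Dvd.intro (3 * X ^ 2) rfl : Q ∣ Q * (3 * X ^ 2))
    convert this using 1
    rw [hQdef]; push_cast; ring
  have hQX : ¬ Q ∣ X := fun h => by
    have := natDegree_le_of_dvd h X_ne_zero
    rw [hQdeg, natDegree_X] at this; omega
  have hQ17 : ¬ Q ∣ X - 17 := fun h => by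
    rw [show (X - 17 : (ZMod p)[X]) = X - C 17 by simp [map_ofNat C 17]] at h
    have := natDegree_le_of_dvd h (X_sub_C_ne_zero _)
    rw [hQdeg, natDegree_X_sub_C] at this; omega
  have hQc : Q ∣ ((2 * j + 5 : ℕ) : (ZMod p)[X]) := by
    refine (hQ.prime.dvd_or_dvd hI2).resolve_right fun h => ?_
    rcases hQ.prime.dvd_or_dvd h with h | h
    · exact hQX (hQ.prime.dvd_of_dvd_pow h)
    · exact hQ17 h
  have hz : ((2 * j + 5 : ℕ) : ZMod p) = 0 := by
    by_contra hne
    rw [← map_natCast (C : ZMod p →+* (ZMod p)[X])] at hQc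
    exact hQ.not_isUnit (isUnit_of_dvd_unit hQc (isUnit_C.2 (isUnit_iff_ne_zero.2 hne)))
  rw [ZMod.natCast_eq_zero_iff] at hz
  have := Nat.le_of_dvd (by omega) hz
  rw [hqdeg] at hnd
  omega

open Polynomial in
theorem multiplicity_le_two_of_binomial {p : ℕ} [Fact p.Prime] (hp : 3 < p)
    {q y : (ZMod p)[X]} (hq : Irreducible q)
    (hdeg : 2 * y.natDegree < p) (h0 : y.coeff 0 ≠ 0) {p₁ p₀ : (ZMod p)[X]}
    (h : ((X - 1) * (-8 * X ^ 3)) * derivative (derivative (derivative y))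
      + (24 * X ^ 2 - 36 * X ^ 3) * derivative (derivative y)
      + p₁ * derivative y + p₀ * y = 0) : multiplicity q y ≤ 2 := by
  by_contra! hm
  have hy0 : y ≠ 0 := fun h => h0 (by simp [h])
  obtain ⟨u, hu, hqu⟩ := (FiniteMultiplicity.of_not_isUnit hq.not_isUnit hy0).exists_eq_pow_mul_and_not_dvd
  set m := multiplicity q y
  have hqy : q ∣ y := hu ▸ Dvd.dvd.mul_right (dvd_pow_self q (by omega)) u
  have hu0 : u ≠ 0 := fun h => hqu (h ▸ dvd_zero q)
  have hnd : y.natDegree = m * q.natDegree + u.natDegree := by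
    rw [hu, natDegree_mul (pow_ne_zero _ hq.ne_zero) hu0, natDegree_pow]
  have hq1 : 1 ≤ q.natDegree := hq.natDegree_pos
  have hmp : 2 * m < p := by nlinarith
  obtain ⟨j, hj⟩ : ∃ j, m = j + 3 := ⟨m - 3, by omega⟩
  have hd := prime_dvd_leadingCoeff_of_ode hq.prime (not_dvd_derivative hq) hqu
    (fun i h1 h2 => natCast_zmod_ne_zero h1 (by omega)) (hj ▸ hu) h
  have hX := not_dvd_X_of_dvd hq hqy h0
  have h8 : ∀ (K : Type) [Field K] (q : K[X]), Irreducible q → (2 : K) ≠ 0 → ¬ q ∣ -8 := by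
    intro K _ q hq h2 hd
    refine hq.not_isUnit (isUnit_of_dvd_unit hd ?_)
    rw [show (-8 : K[X]) = C (-(2 * 2 * 2)) by rw [show (-8 : K[X]) = -(2 * 2 * 2) by norm_num]; simp [map_ofNat C 2]]
    exact isUnit_C.2 (isUnit_iff_ne_zero.2 (by simpa using h2))
  have h2' : (2 : ZMod p) ≠ 0 := by
    exact_mod_cast natCast_zmod_ne_zero (p := p) (i := 2) (by omega) (by omega)
  have hQ : Irreducible (X - 1 : (ZMod p)[X]) := by simpa using irreducible_X_sub_C (1 : ZMod p)
  have hqQ : q ∣ X - 1 := by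
    refine (hq.prime.dvd_or_dvd hd).resolve_right fun h => ?_
    rcases hq.prime.dvd_or_dvd h with h | h
    · exact h8 _ q hq h2' h
    · exact hX (hq.prime.dvd_of_dvd_pow h)
  have ha := hq.associated_of_dvd hQ hqQ
  obtain ⟨c, hc⟩ := ha.symm
  set Q := (X - 1 : (ZMod p)[X]) with hQdef
  have hu' : y = Q ^ (j + 3) * (↑c ^ m * u) := by
    rw [hu, ← hj, ← mul_assoc, ← mul_pow, hc]
  have hQu : ¬ Q ∣ ↑c ^ m * u := fun hd => hqu (by
    have := ha.dvd.trans hd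
    rwa [← Units.val_pow_eq_pow_val, (c ^ m).isUnit.dvd_mul_left] at this)
  have hI := prime_dvd_indicial_of_ode (r := -8 * X ^ 3) hQ.prime (not_dvd_derivative hQ) hQu
    (fun i h1 h2 => natCast_zmod_ne_zero h1 (by omega)) hu' h
  have hQ' : derivative Q = 1 := by
    rw [hQdef]; simp
  rw [hQ', hQdef, show (X - 1 : (ZMod p)[X]) = X - C 1 by simp, dvd_iff_isRoot] at hI
  have hz : ((2 * j + 5 : ℕ) : ZMod p) = 0 := by
    have : ((j : ZMod p) + 1) * (-8) + (24 - 36) = 0 := by simpa using hI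
    have h4 : (4 : ZMod p) ≠ 0 := by
      rw [show (4 : ZMod p) = 2 * 2 by norm_num]; exact mul_ne_zero h2' h2'
    apply mul_left_cancel₀ h4
    push_cast
    linear_combination -this
  rw [ZMod.natCast_eq_zero_iff] at hz
  have := Nat.le_of_dvd (by omega) hz
  have : m ≤ y.natDegree := by nlinarith
  omega

theorem exists_pow_mul_eq_of_linear_relation {R L ι : Type*} [CommRing R] [IsDomain R] [CommRing L]
    [IsDomain L] [Algebra R L] [FaithfulSMul R L] (p : ℕ) [Fact p.Prime] [CharP L p]
    (x : ι → L) (w : ι → R) (hx : ∀ i, x i ≠ 0) (hw : ∀ i, w i ≠ 0)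
    (hxw : ∀ i, algebraMap R L (w i) * x i ^ p = x i) (s : Finset ι) :
    ∀ d : ι → R, (∃ i ∈ s, d i ≠ 0) → ∑ i ∈ s, algebraMap R L (d i) * x i = 0 →
    ∃ i ∈ s, ∃ j ∈ s, i ≠ j ∧ ∃ a b : R, a ≠ 0 ∧ b ≠ 0 ∧
      a ^ (p - 1) * w i = b ^ (p - 1) * w j := by
  classical
  have hp1 : p - 1 + 1 = p := Nat.sub_add_cancel (Fact.out : p.Prime).one_le
  induction s using Finset.strongInduction with
  | H s ih =>
    intro d hd hsum
    by_cases hz : ∃ i ∈ s, d i = 0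
    · obtain ⟨i, hi, hdi⟩ := hz
      obtain ⟨j, hj, hdj⟩ := hd
      have hij : j ≠ i := fun h => hdj (h ▸ hdi)
      obtain ⟨a, ha, b, hb, h⟩ := ih (s.erase i) (Finset.erase_ssubset hi) d
        ⟨j, Finset.mem_erase.2 ⟨hij, hj⟩, hdj⟩ (by
          rw [← Finset.add_sum_erase _ _ hi, hdi] at hsum
          simpa using hsum)
      exact ⟨a, Finset.mem_of_mem_erase ha, b, Finset.mem_of_mem_erase hb, h⟩
    push Not at hz
    obtain ⟨m₀, hm₀, hdm₀⟩ := hd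
    set W : ι → R := fun m => ∏ j ∈ s.erase m, w j with hW
    have hWw : ∀ m ∈ s, W m * w m = ∏ j ∈ s, w j := fun m hm => Finset.prod_erase_mul _ _ hm
    have hfrob : ∑ i ∈ s, algebraMap R L (d i ^ p * W i) * x i = 0 := by
      have h1 : ∑ i ∈ s, (algebraMap R L (d i) * x i) ^ p = 0 := by
        rw [← sum_pow_char, hsum, zero_pow (Fact.out : p.Prime).ne_zero]
      have h2 : algebraMap R L (∏ j ∈ s, w j) * ∑ i ∈ s, (algebraMap R L (d i) * x i) ^ p = 0 := by
        rw [h1, mul_zero]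
      rw [Finset.mul_sum] at h2
      rw [← h2]
      refine Finset.sum_congr rfl fun i hi => ?_
      rw [← hWw i hi]
      conv_lhs => rw [← hxw i]
      simp only [map_mul, map_pow]
      ring
    set e : ι → R := fun m => d m₀ * (d m ^ p * W m) - d m₀ ^ p * W m₀ * d m with he
    have he0 : e m₀ = 0 := by simp only [he]; ring
    have hesum : ∑ i ∈ s.erase m₀, algebraMap R L (e i) * x i = 0 := by
      have : ∑ i ∈ s, algebraMap R L (e i) * x i = 0 := by
        have h3 : ∑ i ∈ s, algebraMap R L (e i) * x i
            = algebraMap R L (d m₀) * ∑ i ∈ s, algebraMap R L (d i ^ p * W i) * x i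
              - algebraMap R L (d m₀ ^ p * W m₀) * ∑ i ∈ s, algebraMap R L (d i) * x i := by
          rw [Finset.mul_sum, Finset.mul_sum, ← Finset.sum_sub_distrib]
          refine Finset.sum_congr rfl fun i _ => ?_
          simp only [he, map_mul, map_sub]
          ring
        rw [h3, hfrob, hsum]; simp
      rw [← Finset.add_sum_erase _ _ hm₀, he0] at this
      simpa using this
    by_cases hne : ∃ i ∈ s.erase m₀, e i ≠ 0
    · obtain ⟨a, ha, b, hb, h⟩ := ih _ (Finset.erase_ssubset hm₀) e hne hesum
      exact ⟨a, Finset.mem_of_mem_erase ha, b, Finset.mem_of_mem_erase hb, h⟩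
    push Not at hne
    rcases (s.erase m₀).eq_empty_or_nonempty with h | ⟨m, hm⟩
    · rw [← Finset.add_sum_erase _ _ hm₀, h] at hsum
      simp only [Finset.sum_empty, add_zero, mul_eq_zero] at hsum
      rcases hsum with h | h
      · exact absurd ((FaithfulSMul.algebraMap_injective R L) (h.trans (map_zero _).symm)) hdm₀
      · exact absurd h (hx m₀)
    · have hms := Finset.mem_of_mem_erase hm
      refine ⟨m₀, hm₀, m, hms, (Finset.ne_of_mem_erase hm).symm, d m, d m₀, hz m hms, hdm₀, ?_⟩
      have h0 := hne m hm
      have hP : ∏ j ∈ s, w j ≠ 0 := Finset.prod_ne_zero_iff.2 fun j _ => hw j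
      apply mul_left_cancel₀ (mul_ne_zero (mul_ne_zero hP hdm₀) (hz m hms))
      have e1 := hWw m hms
      have e2 := hWw m₀ hm₀
      simp only [he] at h0
      have q1 : d m ^ p = d m ^ (p - 1) * d m := by rw [← pow_succ, hp1]
      have q2 : d m₀ ^ p = d m₀ ^ (p - 1) * d m₀ := by rw [← pow_succ, hp1]
      rw [q1, q2] at h0
      linear_combination (w m * w m₀) * h0 - (d m₀ * d m ^ (p - 1) * d m * w m₀) * e1
        + (d m₀ * d m₀ ^ (p - 1) * d m * w m) * e2

open Polynomial in
theorem eq_of_pow_mul_pow_eq {K : Type*} [Field K] {p D : ℕ} (hp : p.Prime) (hD : 4 * D + 1 < p)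
    {A g : K[X]} (hA : A.coeff 0 = 1) (hg : g.coeff 0 = 1)
    (mA : ∀ q, Irreducible q → multiplicity q A ≤ 2)
    (mg : ∀ q, Irreducible q → multiplicity q g ≤ 2)
    {i j i' j' : ℕ} (hi : i ≤ D) (hj : j ≤ D) (hi' : i' ≤ D) (hj' : j' ≤ D)
    {a b : K[X]} (ha : a ≠ 0) (hb : b ≠ 0)
    (h : a ^ (p - 1) * (A ^ i * g ^ j) ^ p = b ^ (p - 1) * (A ^ i' * g ^ j') ^ p) :
    A ^ i * g ^ j = A ^ i' * g ^ j' := by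
  have hA0 : A ≠ 0 := fun h => by simp [h] at hA
  have hg0 : g ≠ 0 := fun h => by simp [h] at hg
  have fin : ∀ q, Irreducible q → ∀ y : K[X], y ≠ 0 → FiniteMultiplicity q y :=
    fun q hq y hy => FiniteMultiplicity.of_not_isUnit hq.not_isUnit hy
  have hne : ∀ i j : ℕ, A ^ i * g ^ j ≠ 0 := fun i j =>
    mul_ne_zero (pow_ne_zero _ hA0) (pow_ne_zero _ hg0)
  have mul1 : ∀ q, Irreducible q → ∀ i j : ℕ, multiplicity q (A ^ i * g ^ j)
      = i * multiplicity q A + j * multiplicity q g := fun q hq i j => by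
    rw [multiplicity_mul hq.prime (fin q hq _ (hne i j)),
      (fin q hq _ hA0).multiplicity_pow hq.prime, (fin q hq _ hg0).multiplicity_pow hq.prime]
  have mul2 : ∀ q, Irreducible q → ∀ (c : K[X]) (i j : ℕ), c ≠ 0 →
      multiplicity q (c ^ (p - 1) * (A ^ i * g ^ j) ^ p)
      = (p - 1) * multiplicity q c + p * (i * multiplicity q A + j * multiplicity q g) :=
    fun q hq c i j hc => by
      rw [multiplicity_mul hq.prime
        (fin q hq _ (mul_ne_zero (pow_ne_zero _ hc) (pow_ne_zero _ (hne i j)))),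
        (fin q hq _ hc).multiplicity_pow hq.prime,
        (fin q hq _ (hne i j)).multiplicity_pow hq.prime, mul1 q hq]
  have key : ∀ q, Irreducible q →
      multiplicity q (A ^ i * g ^ j) = multiplicity q (A ^ i' * g ^ j') := fun q hq => by
    have h1 := congrArg (multiplicity q) h
    rw [mul2 q hq a i j ha, mul2 q hq b i' j' hb] at h1
    rw [mul1 q hq, mul1 q hq]
    have b1 := mA q hq
    have b2 := mg q hq
    have c1 : i * multiplicity q A + j * multiplicity q g ≤ 4 * D := by nlinarith
    have c2 : i' * multiplicity q A + j' * multiplicity q g ≤ 4 * D := by nlinarith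
    generalize i * multiplicity q A + j * multiplicity q g = u at h1 c1 ⊢
    generalize i' * multiplicity q A + j' * multiplicity q g = v at h1 c2 ⊢
    generalize multiplicity q a = α at h1
    generalize multiplicity q b = β at h1
    obtain ⟨P, rfl⟩ : ∃ P, p = P + 1 := ⟨p - 1, by omega⟩
    simp only [Nat.add_sub_cancel] at h1
    have h2 : (P * (α + u) + u) % P = (P * (β + v) + v) % P := by congr 1; linarith
    rw [Nat.mul_add_mod, Nat.mul_add_mod, Nat.mod_eq_of_lt (by omega),
      Nat.mod_eq_of_lt (by omega)] at h2
    exact h2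
  have dvd : ∀ x y : K[X], x ≠ 0 → y ≠ 0 →
      (∀ q, Irreducible q → multiplicity q x = multiplicity q y) → x ∣ y := fun x y hx hy hxy => by
    rw [UniqueFactorizationMonoid.dvd_iff_emultiplicity_le hx]
    intro q hq
    rw [(fin q hq.irreducible x hx).emultiplicity_eq_multiplicity,
      (fin q hq.irreducible y hy).emultiplicity_eq_multiplicity, hxy q hq.irreducible]
  have hass : Associated (A ^ i * g ^ j) (A ^ i' * g ^ j') :=
    associated_of_dvd_dvd (dvd _ _ (hne _ _) (hne _ _) key)
      (dvd _ _ (hne _ _) (hne _ _) fun q hq => (key q hq).symm)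
  obtain ⟨c, hc⟩ := hass
  obtain ⟨r, -, hr⟩ := Polynomial.isUnit_iff.1 c.isUnit
  have h0 := congrArg (fun y : K[X] => y.coeff 0) hc
  rw [coeff_zero_eq_eval_zero] at hA hg
  simp only [← hr, coeff_zero_eq_eval_zero, eval_mul, eval_pow, hA, hg, one_pow, one_mul,
    eval_C] at h0
  rw [← hc, ← hr, h0]
  simp

open Polynomial in
theorem exponents_eq_of_pow_mul_pow_eq {p D : ℕ} [Fact p.Prime] (hp : 3757 < p) (hD : D < p)
    {A g : (ZMod p)[X]} (hA : A.coeff 0 = 1) (hA1 : A.coeff 1 = 5) (hA2 : A.coeff 2 = 73)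
    (hg : g.coeff 0 = 1) (hg1 : 8 * g.coeff 1 = 1) (hg2 : 512 * g.coeff 2 = 27)
    {i j i' j' : ℕ} (hi : i ≤ D) (hj : j ≤ D) (hi' : i' ≤ D) (hj' : j' ≤ D)
    (h : A ^ i * g ^ j = A ^ i' * g ^ j') : i = i' ∧ j = j' := by
  have hA0 : A ≠ 0 := fun h => by simp [h] at hA
  have hg0 : g ≠ 0 := fun h => by simp [h] at hg
  have dp : ∀ (y : (ZMod p)[X]) (n : ℕ), y * derivative (y ^ n) = C (n : ZMod p) * y ^ n * derivative y := by
    intro y n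
    rcases n with _ | n
    · simp
    · rw [derivative_pow]; simp only [Nat.add_sub_cancel]; ring
  have dF : ∀ i j : ℕ, A * g * derivative (A ^ i * g ^ j)
      = A ^ i * g ^ j * (C (i : ZMod p) * (derivative A * g) + C (j : ZMod p) * (derivative g * A)) := by
    intro i j
    rw [derivative_mul]
    linear_combination g * g ^ j * dp A i + A * A ^ i * dp g j
  have hrel : C ((i : ZMod p) - i') * (derivative A * g)
      + C ((j : ZMod p) - j') * (derivative g * A) = 0 := by
    apply mul_left_cancel₀ (mul_ne_zero (pow_ne_zero i hA0) (pow_ne_zero j hg0))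
    have e1 := dF i j
    have e2 := dF i' j'
    rw [← h] at e2
    rw [C_sub, C_sub]
    linear_combination e2 - e1
  have c0 := congrArg (fun y : (ZMod p)[X] => y.coeff 0) hrel
  have c1 := congrArg (fun y : (ZMod p)[X] => y.coeff 1) hrel
  simp only [coeff_add, coeff_C_mul] at c0 c1
  simp only [mul_coeff_zero, mul_coeff_one, coeff_derivative, hA, hA1, hA2, hg, coeff_zero,
    zero_add, Nat.cast_zero, Nat.cast_one, mul_one, one_add_one_eq_two] at c0 c1
  have hne : ∀ n : ℕ, 1 ≤ n → n ≤ 3757 → (n : ZMod p) ≠ 0 := fun n h1 h2 =>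
    natCast_zmod_ne_zero h1 (by omega)
  have h3757 : (3757 : ZMod p) ≠ 0 := by exact_mod_cast hne 3757 (by norm_num) le_rfl
  set a : ZMod p := (i : ZMod p) - i' with ha
  set b : ZMod p := (j : ZMod p) - j' with hb
  have hab : b = -40 * a := by
    linear_combination 8 * c0 - b * hg1
  have ha0 : a = 0 := by
    apply mul_left_cancel₀ h3757
    rw [hab] at c1
    linear_combination 32 * c1 + (780 * a) * hg1 + (5 * a) * hg2
  have hb0 : b = 0 := by rw [hab, ha0, mul_zero]
  have fin : ∀ m n : ℕ, m ≤ D → n ≤ D → (m : ZMod p) - n = 0 → m = n := fun m n hm hn h => by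
    have := (ZMod.natCast_eq_natCast_iff' m n p).1 (sub_eq_zero.1 h)
    rwa [Nat.mod_eq_of_lt (by omega), Nat.mod_eq_of_lt (by omega)] at this
  exact ⟨fin _ _ hi hi' ha0, fin _ _ hj hj' hb0⟩

section ModP

open PowerSeries

variable {p : ℕ} [Fact p.Prime]

variable (p) in
/-- The Apéry power series modulo `p`. -/
noncomputable def aperyZMod : PowerSeries (ZMod p) := mk fun n => (aperyNumber n : ZMod p)

variable (p) in
/-- The power series of cubes of central binomial coefficients modulo `p`. -/
noncomputable def binomialZMod : PowerSeries (ZMod p) :=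
  mk fun n => (n.centralBinom : ZMod p) ^ 3 / 64 ^ n

variable (p) in
/-- The `₃F₂((-1/2,1/2,1/2),(1,1))` power series modulo `p`. -/
noncomputable def hypergeometricZMod : PowerSeries (ZMod p) :=
  mk fun n => -((n.centralBinom : ZMod p) ^ 2 * centralBinomQuotient n) / 64 ^ n

theorem aperyZMod_eq : aperyZMod p = (trunc p (aperyZMod p) : PowerSeries (ZMod p)) * aperyZMod p ^ p :=
  mk_eq_trunc_mul_pow fun _ h _ => aperyNumber_zmod h _

theorem binomialZMod_eq :
    binomialZMod p = (trunc p (binomialZMod p) : PowerSeries (ZMod p)) * binomialZMod p ^ p :=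
  mk_eq_trunc_mul_pow fun _ h _ => by
    rw [centralBinom_zmod h, sixtyFour_pow_zmod, div_mul_div_comm, mul_pow]

theorem hypergeometricZMod_eq :
    hypergeometricZMod p
      = (trunc p (hypergeometricZMod p) : PowerSeries (ZMod p)) * binomialZMod p ^ p :=
  mk_eq_trunc_mul_pow fun n₀ h n₁ => by
    have e := centralBinom_mul_centralBinomQuotient_zmod h n₁
    rw [sixtyFour_pow_zmod, div_mul_div_comm]
    congr 1
    have e2 := centralBinom_zmod h n₁
    rw [pow_two, mul_assoc, e, e2]
    ring

theorem sixtyFour_zmod_ne_zero (hp : 2 < p) : (64 : ZMod p) ≠ 0 := by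
  have h2 : ((2 : ℕ) : ZMod p) ≠ 0 := natCast_zmod_ne_zero (by norm_num) hp
  have : (64 : ZMod p) = ((2 : ℕ) : ZMod p) ^ 6 := by norm_num
  rw [this]
  exact pow_ne_zero _ h2

theorem aperyZMod_recurrence (n : ℕ) : ((n : ZMod p) + 2) ^ 3 * aperyNumber (n + 2)
      = (34 * ((n : ZMod p) + 1) ^ 3 + 51 * ((n : ZMod p) + 1) ^ 2 + 27 * ((n : ZMod p) + 1) + 5)
          * aperyNumber (n + 1) - ((n : ZMod p) + 1) ^ 3 * aperyNumber n := by
  exact_mod_cast congrArg (Int.cast : ℤ → ZMod p) (aperyNumber_recurrence n)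

theorem binomialZMod_recurrence (hp : 2 < p) (n : ℕ) :
    8 * ((n : ZMod p) + 1) ^ 3 * ((n + 1).centralBinom ^ 3 / 64 ^ (n + 1))
      = (2 * (n : ZMod p) + 1) ^ 3 * (n.centralBinom ^ 3 / 64 ^ n) := by
  have h : ((n : ZMod p) + 1) * (n + 1).centralBinom = 2 * (2 * n + 1) * n.centralBinom := by
    exact_mod_cast congrArg (Nat.cast : ℕ → ZMod p) (Nat.succ_mul_centralBinom_succ n)
  have h64 := sixtyFour_zmod_ne_zero hp
  have h3 : ((n : ZMod p) + 1) ^ 3 * (n + 1).centralBinom ^ 3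
      = 8 * (2 * n + 1) ^ 3 * n.centralBinom ^ 3 := by
    rw [← mul_pow, h]; ring
  rw [pow_succ (64 : ZMod p) n]
  have h64' : (64 : ZMod p) ^ n ≠ 0 := pow_ne_zero _ h64
  generalize (64 : ZMod p) ^ n = t at *
  field_simp
  linear_combination 8 * h3

theorem coeff_trunc_aperyZMod (n : ℕ) :
    (trunc p (aperyZMod p)).coeff n = if n < p then (aperyNumber n : ZMod p) else 0 := by
  rw [coeff_trunc, aperyZMod, coeff_mk]

theorem coeff_trunc_binomialZMod (n : ℕ) : (trunc p (binomialZMod p)).coeff n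
    = if n < p then (n.centralBinom : ZMod p) ^ 3 / 64 ^ n else 0 := by
  rw [coeff_trunc, binomialZMod, coeff_mk]

theorem natDegree_trunc_zmod_lt (φ : PowerSeries (ZMod p)) : (trunc p φ).natDegree < p := by
  have h := natDegree_trunc_lt φ (p - 1)
  rwa [Nat.sub_add_cancel (Fact.out : p.Prime).one_le] at h

theorem multiplicity_trunc_aperyZMod_le (hp : 3 < p) (h2 : ¬ IsSquare (2 : ZMod p))
    {q : Polynomial (ZMod p)} (hq : Irreducible q) :
    multiplicity q (trunc p (aperyZMod p)) ≤ 2 := by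
  refine multiplicity_le_two_of_apery hp h2 hq (natDegree_trunc_zmod_lt _) ?_
    (apery_ode _ ?_ fun n => ?_)
  · rw [coeff_trunc_aperyZMod, if_pos (by omega)]
    simp [aperyNumber]
  · rw [coeff_trunc_aperyZMod, coeff_trunc_aperyZMod, if_pos (by omega), if_pos (by omega)]
    norm_num [aperyNumber, Finset.sum_range_succ]
  · have h := aperyZMod_recurrence (p := p) n
    simp only [coeff_trunc_aperyZMod]
    rcases lt_or_ge (n + 2) p with h' | h'
    · rw [if_pos h', if_pos (by omega), if_pos (by omega), h]
    · rcases eq_or_lt_of_le h' with h' | h'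
      · rw [if_neg (by omega), if_pos (by omega), if_pos (by omega), ← h]
        have : ((n : ZMod p) + 2) = 0 := by
          have := congrArg (Nat.cast : ℕ → ZMod p) h'
          push_cast at this
          rw [← this, ZMod.natCast_self]
        rw [this]; ring
      · rcases eq_or_lt_of_le (Nat.lt_succ_iff.1 h') with h' | h'
        · rw [if_neg (by omega), if_neg (by omega), if_pos (by omega)]
          have : ((n : ZMod p) + 1) = 0 := by
            have := congrArg (Nat.cast : ℕ → ZMod p) h'
            push_cast at this
            rw [← this, ZMod.natCast_self]
          rw [this]; ring
        · rw [if_neg (by omega), if_neg (by omega), if_neg (by omega)]; ring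

theorem two_mul_natDegree_trunc_binomialZMod_lt : 2 * (trunc p (binomialZMod p)).natDegree < p := by
  by_contra! h
  have hlt := natDegree_trunc_zmod_lt (binomialZMod p)
  set n := (trunc p (binomialZMod p)).natDegree with hn
  have h0 : (trunc p (binomialZMod p)).coeff n = 0 := by
    obtain ⟨c, hc⟩ := Nat.exists_eq_add_of_le h
    have e := choose_zmod (show c < p by omega) hlt 1 0
    rw [mul_zero, add_zero, mul_one, add_comm c, ← hc, Nat.choose_eq_zero_of_lt (show c < n by omega),
      ← Nat.centralBinom_eq_two_mul_choose] at e
    rw [coeff_trunc_binomialZMod, if_pos hlt, e]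
    simp
  have hz : trunc p (binomialZMod p) = 0 := by
    rwa [hn, Polynomial.coeff_natDegree, Polynomial.leadingCoeff_eq_zero] at h0
  have hp := (Fact.out : p.Prime).pos
  rw [hz, Polynomial.natDegree_zero] at hn
  omega

theorem multiplicity_trunc_binomialZMod_le (hp : 3 < p)
    {q : Polynomial (ZMod p)} (hq : Irreducible q) :
    multiplicity q (trunc p (binomialZMod p)) ≤ 2 := by
  refine multiplicity_le_two_of_binomial hp hq two_mul_natDegree_trunc_binomialZMod_lt ?_
    (binomial_ode _ fun n => ?_)
  · rw [coeff_trunc_binomialZMod, if_pos (by omega)]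
    simp
  · have h := binomialZMod_recurrence (p := p) (by omega) n
    simp only [coeff_trunc_binomialZMod]
    rcases lt_or_ge (n + 1) p with h' | h'
    · rw [if_pos h', if_pos (by omega), h]
    · rcases eq_or_lt_of_le h' with h' | h'
      · rw [if_neg (by omega), if_pos (by omega), ← h]
        have : ((n : ZMod p) + 1) = 0 := by
          have := congrArg (Nat.cast : ℕ → ZMod p) h'
          push_cast at this
          rw [← this, ZMod.natCast_self]
        rw [this]; ring
      · rw [if_neg (by omega), if_neg (by omega)]; ring

theorem no_relation_zmod {D : ℕ} (hp : 3757 < p) (hD : 4 * D + 1 < p)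
    (h2 : ¬ IsSquare (2 : ZMod p)) (s : Finset (Fin 2 →₀ ℕ)) (hs : ∀ m ∈ s, ∀ i, m i ≤ D)
    (d : (Fin 2 →₀ ℕ) → Polynomial (ZMod p)) (hd : ∃ m ∈ s, d m ≠ 0)
    (hrel : ∑ m ∈ s, (d m : PowerSeries (ZMod p))
      * ((aperyZMod p ^ p) ^ m 0 * (binomialZMod p ^ p) ^ m 1) = 0) : False := by
  have hpp : p.Prime := Fact.out
  set A := trunc p (aperyZMod p) with hA
  set g := trunc p (binomialZMod p) with hg
  have : FaithfulSMul (Polynomial (ZMod p)) (PowerSeries (ZMod p)) :=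
    (faithfulSMul_iff_algebraMap_injective _ _).2 (Polynomial.coe_injective _)
  have : CharP (PowerSeries (ZMod p)) p := charP_of_injective_algebraMap
    (algebraMap (ZMod p) (PowerSeries (ZMod p))).injective p
  have eA : (A : PowerSeries (ZMod p)) * aperyZMod p ^ p = aperyZMod p := aperyZMod_eq.symm
  have eg : (g : PowerSeries (ZMod p)) * binomialZMod p ^ p = binomialZMod p :=
    binomialZMod_eq.symm
  have cA : A.coeff 0 = 1 ∧ A.coeff 1 = 5 ∧ A.coeff 2 = 73 := by
    simp only [hA, coeff_trunc_aperyZMod]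
    rw [if_pos (by omega), if_pos (by omega), if_pos (by omega)]
    norm_num [aperyNumber, Finset.sum_range_succ, Nat.choose]
  have h64 : (64 : ZMod p) ≠ 0 := sixtyFour_zmod_ne_zero (by omega)
  have cg : g.coeff 0 = 1 ∧ 8 * g.coeff 1 = 1 ∧ 512 * g.coeff 2 = 27 := by
    simp only [hg, coeff_trunc_binomialZMod]
    rw [if_pos (by omega), if_pos (by omega), if_pos (by omega)]
    have c1 : Nat.centralBinom 1 = 2 := by decide
    have c2 : Nat.centralBinom 2 = 6 := by decide
    refine ⟨by simp, ?_, ?_⟩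
    · rw [c1, pow_one]
      field_simp; norm_num
    · rw [c2]
      field_simp; norm_num
  have hA0 : A ≠ 0 := fun h => by simp [h] at cA
  have hg0 : g ≠ 0 := fun h => by simp [h] at cg
  have hα : aperyZMod p ≠ 0 := fun h => by
    have := congrArg (PowerSeries.coeff 0) h
    simp [aperyZMod, aperyNumber] at this
  have hγ : binomialZMod p ≠ 0 := fun h => by
    have := congrArg (PowerSeries.coeff 0) h
    simp [binomialZMod] at this
  obtain ⟨m, hm, m', hm', hne, a, b, ha, hb, hab⟩ := exists_pow_mul_eq_of_linear_relation
    (R := Polynomial (ZMod p)) (L := PowerSeries (ZMod p)) p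
    (fun m : Fin 2 →₀ ℕ => (aperyZMod p ^ p) ^ m 0 * (binomialZMod p ^ p) ^ m 1)
    (fun m => (A ^ m 0 * g ^ m 1) ^ p)
    (fun m => mul_ne_zero (pow_ne_zero _ (pow_ne_zero _ hα)) (pow_ne_zero _ (pow_ne_zero _ hγ)))
    (fun m => pow_ne_zero _ (mul_ne_zero (pow_ne_zero _ hA0) (pow_ne_zero _ hg0)))
    (fun m => by
      change ((((A ^ m 0 * g ^ m 1) ^ p : Polynomial (ZMod p)) : PowerSeries (ZMod p))) * _ = _
      push_cast
      rw [← mul_pow, mul_mul_mul_comm, ← mul_pow, ← mul_pow, eA, eg, mul_pow, ← pow_mul, ← pow_mul,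
        mul_comm, ← pow_mul, ← pow_mul]
      ring) s d hd hrel
  have h := eq_of_pow_mul_pow_eq hpp hD cA.1 cg.1
    (fun q hq => multiplicity_trunc_aperyZMod_le (by omega) h2 hq)
    (fun q hq => multiplicity_trunc_binomialZMod_le (by omega) hq)
    (hs m hm 0) (hs m hm 1) (hs m' hm' 0) (hs m' hm' 1) ha hb hab
  obtain ⟨h0, h1⟩ := exponents_eq_of_pow_mul_pow_eq hp (by omega) cA.1 cA.2.1 cA.2.2
    cg.1 cg.2.1 cg.2.2 (hs m hm 0) (hs m hm 1) (hs m' hm' 0) (hs m' hm' 1) h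
  exact hne (Finsupp.ext fun i => by fin_cases i <;> assumption)

end ModP

section Reduction

open PowerSeries

theorem map_iterate_derivative {R S : Type*} [CommRing R] [CommRing S] (f : R →+* S) (n : ℕ)
    (φ : PowerSeries R) :
    map f ((fun F => derivative R F)^[n] φ) = (fun F => derivative S F)^[n] (map f φ) := by
  induction n with
  | zero => rfl
  | succ n ih =>
    rw [Function.iterate_succ_apply', Function.iterate_succ_apply', ← ih]
    ext m
    simp [coeff_derivative]

theorem iterate_derivative_coe_mul_pow_char {K : Type*} [CommRing K] (p : ℕ) [CharP K p] (n : ℕ)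
    (P : Polynomial K) (φ : PowerSeries K) :
    (fun F => derivative K F)^[n] ((P : PowerSeries K) * φ ^ p)
      = (Polynomial.derivative^[n] P : Polynomial K) * φ ^ p := by
  induction n with
  | zero => rfl
  | succ n ih =>
    have : (p : PowerSeries K) = 0 := by
      rw [← map_natCast (C (R := K)), CharP.cast_eq_zero, map_zero]
    rw [Function.iterate_succ_apply', Function.iterate_succ_apply', ih]
    simp only [Derivation.leibniz, smul_eq_mul, derivative_pow, this, derivative_coe]
    ring

/-- The Apéry power series. -/
noncomputable def aperySeries (R : Type*) [CommRing R] : PowerSeries R :=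
  mk fun n => (aperyNumber n : R)

/-- The `₃F₂((-1/2,1/2,1/2),(1,1))` power series, where `e` stands for `1/2`. -/
noncomputable def hypergeometricSeries {R : Type*} [CommRing R] (e : R) : PowerSeries R :=
  mk fun n => -((n.centralBinom : R) ^ 2 * centralBinomQuotient n) * e ^ (6 * n)

theorem map_aperySeries {R S : Type*} [CommRing R] [CommRing S] (f : R →+* S) :
    map f (aperySeries R) = aperySeries S := by
  ext n; simp [aperySeries]

theorem map_hypergeometricSeries {R S : Type*} [CommRing R] [CommRing S] (f : R →+* S) (e : R) :
    map f (hypergeometricSeries e) = hypergeometricSeries (f e) := by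
  ext n; simp [hypergeometricSeries]

theorem hypergeometricSeries_zmod {p : ℕ} [Fact p.Prime] {e : ZMod p} (he : 2 * e = 1) :
    hypergeometricSeries e = hypergeometricZMod p := by
  have h2 : (2 : ZMod p) ≠ 0 := left_ne_zero_of_mul_eq_one he
  have h64 : e ^ 6 = (64 : ZMod p)⁻¹ := by
    rw [eq_inv_of_mul_eq_one_right he, inv_pow]; norm_num
  ext n
  simp only [hypergeometricSeries, hypergeometricZMod, coeff_mk]
  rw [pow_mul, h64, inv_pow, div_eq_mul_inv]

theorem centralBinomQuotient_ne_zero (n : ℕ) : centralBinomQuotient n ≠ 0 := fun h => by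
  have := centralBinomQuotient_mul n
  rw [h, mul_zero] at this
  exact n.centralBinom_ne_zero (by exact_mod_cast this.symm)

theorem aperyNumber_pos (n : ℕ) : 0 < aperyNumber n := by
  unfold aperyNumber
  refine Finset.sum_pos (fun j hj => ?_) (by simp)
  have h1 := Nat.choose_pos (Nat.lt_succ_iff.1 (Finset.mem_range.1 hj))
  have h2 := Nat.choose_pos (Nat.le_add_left j n)
  positivity

theorem intCast_zmod_ne_zero {p : ℕ} {c : ℤ} (hc : c ≠ 0) (h : c.natAbs < p) :
    (c : ZMod p) ≠ 0 := by
  rw [Ne, ZMod.intCast_zmod_eq_zero_iff_dvd]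
  exact fun hd => absurd (Int.natAbs_le_of_dvd_ne_zero hd hc) (by simpa using h)

theorem no_relation_reduction (s k : ℕ) (t : Finset (Fin 2 →₀ ℕ))
    (q : (Fin 2 →₀ ℕ) → Polynomial ℤ) (hq : ∃ m ∈ t, q m ≠ 0)
    (hrel : ∑ m ∈ t, (((q m).map (Int.castRingHom ℂ) : Polynomial ℂ) : PowerSeries ℂ)
      * (((fun F => derivative ℂ F)^[s] (aperySeries ℂ)) ^ m 0
        * ((fun F => derivative ℂ F)^[k] (hypergeometricSeries (2⁻¹ : ℂ))) ^ m 1) = 0) : False := by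
  obtain ⟨μ, hμ, hqμ⟩ := hq
  set D := t.sup fun m => m 0 + m 1 with hD
  set c := (q μ).leadingCoeff with hc
  set u : ℤ := s.factorial * aperyNumber s with hu
  set v : ℤ := k.factorial * (-(k.centralBinom ^ 2 * centralBinomQuotient k)) with hv
  obtain ⟨p, hlt, hpp, hmod⟩ := Nat.forall_exists_prime_gt_and_modEq
    (3757 + 4 * D + 1 + c.natAbs + u.natAbs + v.natAbs + s + k) (q := 8) (a := 3) (by norm_num)
    (by norm_num)
  have : Fact p.Prime := ⟨hpp⟩
  have h2 : ¬ IsSquare (2 : ZMod p) := by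
    rw [ZMod.exists_sq_eq_two_iff (by omega), show p % 8 = 3 from hmod]
    norm_num
  have hc0 : (c : ZMod p) ≠ 0 :=
    intCast_zmod_ne_zero (Polynomial.leadingCoeff_ne_zero.2 hqμ) (by omega)
  have hu0 : (u : ZMod p) ≠ 0 := intCast_zmod_ne_zero (by
    have := aperyNumber_pos s
    have := s.factorial_pos
    positivity) (by omega)
  have hv0 : (v : ZMod p) ≠ 0 := intCast_zmod_ne_zero
    (mul_ne_zero (by exact_mod_cast k.factorial_ne_zero) (neg_ne_zero.2 (mul_ne_zero
      (pow_ne_zero _ (by exact_mod_cast k.centralBinom_ne_zero)) (centralBinomQuotient_ne_zero k))))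
    (by omega)
  have h2p : (2 : ZMod p) ≠ 0 := by
    exact_mod_cast natCast_zmod_ne_zero (p := p) (i := 2) (by norm_num) (by omega)
  have uC : IsUnit (Int.castRingHom ℂ 2) := by simp
  have uP : IsUnit (Int.castRingHom (ZMod p) 2) := by simpa using h2p
  set ι : Localization.Away (2 : ℤ) →+* ℂ := IsLocalization.Away.lift 2 uC with hι
  set ψ : Localization.Away (2 : ℤ) →+* ZMod p := IsLocalization.Away.lift 2 uP with hψ
  set e : Localization.Away (2 : ℤ) := IsLocalization.Away.invSelf (2 : ℤ) with he
  have he2 : (2 : Localization.Away (2 : ℤ)) * e = 1 := by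
    have := IsLocalization.Away.mul_invSelf (S := Localization.Away (2 : ℤ)) (2 : ℤ)
    simpa using this
  have hinj : Function.Injective ι := by
    rw [hι]
    unfold IsLocalization.Away.lift
    rw [IsLocalization.lift_injective_iff]
    intro x y
    have : Function.Injective (algebraMap ℤ (Localization.Away (2 : ℤ))) :=
      IsLocalization.injective _ (powers_le_nonZeroDivisors_of_noZeroDivisors (x := (2 : ℤ)) (by norm_num))
    rw [this.eq_iff]
    simp
  have hιe : ι e = 2⁻¹ := by
    have := congrArg ι he2
    rw [map_mul, map_one, map_ofNat] at this
    exact eq_inv_of_mul_eq_one_right this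
  have hψe : 2 * ψ e = 1 := by
    have := congrArg ψ he2
    rwa [map_mul, map_one, map_ofNat] at this
  have hrelΛ : ∑ m ∈ t, (((q m).map (Int.castRingHom (Localization.Away (2 : ℤ))) :
      Polynomial (Localization.Away (2 : ℤ))) : PowerSeries (Localization.Away (2 : ℤ)))
      * (((fun F => derivative _ F)^[s] (aperySeries (Localization.Away (2 : ℤ)))) ^ m 0
        * ((fun F => derivative _ F)^[k] (hypergeometricSeries e)) ^ m 1) = 0 := by
    have hinj' : Function.Injective (map ι) := fun a b hab => by
      ext n
      exact hinj (by simpa using congrArg (coeff n) hab)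
    apply hinj'
    rw [map_zero, map_sum, ← hrel]
    refine Finset.sum_congr rfl fun m _ => ?_
    rw [map_mul, map_mul, map_pow, map_pow, map_iterate_derivative, map_iterate_derivative,
      map_aperySeries, map_hypergeometricSeries, hιe, ← Polynomial.polynomial_map_coe,
      Polynomial.map_map, Subsingleton.elim (ι.comp _) (Int.castRingHom ℂ)]
  have hrelp := congrArg (map ψ) hrelΛ
  rw [map_zero, map_sum] at hrelp
  refine no_relation_zmod (D := D) (by omega) (by omega) h2 t (fun m hm i => ?_)
    (fun m => (q m).map (Int.castRingHom (ZMod p))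
      * ((Polynomial.derivative^[s] (trunc p (aperyZMod p))) ^ m 0
      * (Polynomial.derivative^[k] (trunc p (hypergeometricZMod p))) ^ m 1)) ⟨μ, hμ, ?_⟩ ?_
  · have : m 0 + m 1 ≤ D := Finset.le_sup (f := fun m : Fin 2 →₀ ℕ => m 0 + m 1) hm
    fin_cases i <;> simp <;> omega
  · refine mul_ne_zero ?_ (mul_ne_zero (pow_ne_zero _ ?_) (pow_ne_zero _ ?_))
    · exact fun h => hc0 (by simpa using congrArg (fun y => y.coeff (q μ).natDegree) h)
    · refine fun h => hu0 ?_
      have := congrArg (fun y => y.coeff 0) h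
      simp only [Polynomial.coeff_iterate_derivative, coeff_trunc_aperyZMod, zero_add] at this
      rw [if_pos (by omega), Nat.descFactorial_self] at this
      rw [hu]
      push_cast
      simpa using this
    · refine fun h => hv0 ?_
      have := congrArg (fun y => y.coeff 0) h
      simp only [Polynomial.coeff_iterate_derivative, coeff_trunc, zero_add, hypergeometricZMod,
        coeff_mk] at this
      rw [if_pos (by omega), Nat.descFactorial_self] at this
      have h64 := sixtyFour_zmod_ne_zero (p := p) (by omega)
      rw [hv]
      push_cast
      simpa [h64] using this
  · have eA := iterate_derivative_coe_mul_pow_char p s (trunc p (aperyZMod p)) (aperyZMod p)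
    rw [← aperyZMod_eq] at eA
    have eF := iterate_derivative_coe_mul_pow_char p k (trunc p (hypergeometricZMod p))
      (binomialZMod p)
    rw [← hypergeometricZMod_eq] at eF
    rw [← hrelp]
    refine Finset.sum_congr rfl fun m _ => ?_
    rw [map_mul, map_mul, map_pow, map_pow, map_iterate_derivative, map_iterate_derivative,
      map_aperySeries, map_hypergeometricSeries, hypergeometricSeries_zmod hψe,
      ← Polynomial.polynomial_map_coe, Polynomial.map_map,
      Subsingleton.elim (ψ.comp _) (Int.castRingHom (ZMod p)),
      show aperySeries (ZMod p) = aperyZMod p from rfl, eA, eF]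
    push_cast
    ring

end Reduction

section Evaluation

open PowerSeries

theorem coeff_mul_mul_pow (z : ℂ) (φ ψ : PowerSeries ℂ) (n : ℕ) :
    coeff n (φ * ψ) * z ^ n
      = ∑ kl ∈ Finset.HasAntidiagonal.antidiagonal n,
        (coeff kl.1 φ * z ^ kl.1) * (coeff kl.2 ψ * z ^ kl.2) := by
  rw [coeff_mul, Finset.sum_mul]
  refine Finset.sum_congr rfl fun kl hkl => ?_
  rw [← Finset.HasAntidiagonal.mem_antidiagonal.1 hkl, pow_add]
  ring

/-- A power series converges absolutely at `z`. -/
def AbsConvergentAt (z : ℂ) (φ : PowerSeries ℂ) : Prop :=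
  Summable fun n => ‖coeff n φ * z ^ n‖

theorem AbsConvergentAt.mul {z : ℂ} {φ ψ : PowerSeries ℂ} (hφ : AbsConvergentAt z φ)
    (hψ : AbsConvergentAt z ψ) : AbsConvergentAt z (φ * ψ) := by
  have h := summable_norm_sum_mul_antidiagonal_of_summable_norm
    (f := fun n => coeff n φ * z ^ n) (g := fun n => coeff n ψ * z ^ n) hφ hψ
  exact h.congr fun n => by rw [coeff_mul_mul_pow]

theorem AbsConvergentAt.add {z : ℂ} {φ ψ : PowerSeries ℂ} (hφ : AbsConvergentAt z φ)
    (hψ : AbsConvergentAt z ψ) : AbsConvergentAt z (φ + ψ) := by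
  have h : Summable fun n => ‖coeff n φ * z ^ n‖ + ‖coeff n ψ * z ^ n‖ := Summable.add hφ hψ
  refine Summable.of_nonneg_of_le (fun _ => norm_nonneg _) (fun n => ?_) h
  rw [map_add, add_mul]
  exact norm_add_le _ _

theorem absConvergentAt_algebraMap (z c : ℂ) :
    AbsConvergentAt z (algebraMap ℂ (PowerSeries ℂ) c) := by
  refine summable_of_ne_finset_zero (s := {0}) fun n hn => ?_
  rw [Finset.mem_singleton] at hn
  rw [PowerSeries.algebraMap_apply, coeff_C, if_neg hn, zero_mul, norm_zero]

/-- The algebra of power series that converge absolutely at `z`. -/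
def absConvergent (z : ℂ) : Subalgebra ℂ (PowerSeries ℂ) where
  carrier := {φ | AbsConvergentAt z φ}
  mul_mem' := AbsConvergentAt.mul
  add_mem' := AbsConvergentAt.add
  algebraMap_mem' := absConvergentAt_algebraMap z

theorem hasSum_of_mem_absConvergent {z : ℂ} (φ : absConvergent z) :
    HasSum (fun n => coeff n φ.1 * z ^ n) (∑' n, coeff n φ.1 * z ^ n) := by
  have h : AbsConvergentAt z φ.1 := φ.2
  exact (Summable.of_norm h).hasSum

/-- Evaluation at `z` of power series that converge absolutely at `z`. -/
noncomputable def evalAbsConvergent (z : ℂ) : absConvergent z →+* ℂ where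
  toFun φ := ∑' n, coeff n φ.1 * z ^ n
  map_one' := by
    rw [tsum_eq_single 0 fun n hn => by
      rw [show ((1 : absConvergent z) : PowerSeries ℂ) = 1 from rfl, coeff_one, if_neg hn, zero_mul]]
    simp
  map_zero' := by
    rw [show ((0 : absConvergent z) : PowerSeries ℂ) = 0 from rfl]
    simp
  map_mul' φ ψ := by
    have hφ : AbsConvergentAt z φ.1 := φ.2
    have hψ : AbsConvergentAt z ψ.1 := ψ.2
    rw [tsum_mul_tsum_eq_tsum_sum_antidiagonal_of_summable_norm hφ hψ]
    exact tsum_congr fun n => coeff_mul_mul_pow z φ.1 ψ.1 n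
  map_add' φ ψ := by
    rw [← ((hasSum_of_mem_absConvergent φ).add (hasSum_of_mem_absConvergent ψ)).tsum_eq]
    exact tsum_congr fun n => by
      rw [show ((φ + ψ : absConvergent z) : PowerSeries ℂ) = φ.1 + ψ.1 from rfl, map_add, add_mul]

/-- The exponential series `exp(√3 i z)`. -/
noncomputable def expSeries : PowerSeries ℂ :=
  mk fun n : ℕ => ((Real.sqrt 3 : ℂ) * Complex.I) ^ n / (n.factorial : ℂ)

/-- The Bessel series `J₀(√3 i z)`. -/
noncomputable def besselSeries : PowerSeries ℂ :=
  mk fun m : ℕ => if m % 2 = 0 then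
    (3 : ℂ) ^ (m / 2) / (4 ^ (m / 2) * (((m / 2).factorial : ℂ)) ^ 2) else 0

theorem expSeries_mem (z : ℂ) : expSeries ∈ absConvergent z := by
  have := (NormedSpace.expSeries_div_summable ((Real.sqrt 3 : ℂ) * Complex.I * z)).norm
  refine this.congr fun n => ?_
  rw [expSeries, coeff_mk, mul_pow]
  ring_nf

theorem evalAbsConvergent_expSeries (z : ℂ) :
    evalAbsConvergent z ⟨expSeries, expSeries_mem z⟩
      = Complex.exp ((Real.sqrt 3 : ℂ) * Complex.I * z) := by
  rw [Complex.exp_eq_exp_ℂ, NormedSpace.exp_eq_tsum_div]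
  refine tsum_congr fun n => ?_
  change coeff n expSeries * z ^ n = _
  rw [expSeries, coeff_mk, mul_pow]
  ring

/-- The real coefficients of `besselSeries`. -/
noncomputable def besselCoeff (m : ℕ) : ℝ :=
  if m % 2 = 0 then (3 : ℝ) ^ (m / 2) / (4 ^ (m / 2) * (((m / 2).factorial : ℝ)) ^ 2) else 0

theorem coeff_besselSeries (m : ℕ) : coeff m besselSeries = (besselCoeff m : ℂ) := by
  rw [besselSeries, coeff_mk, besselCoeff]
  split_ifs <;> push_cast <;> rfl

theorem besselCoeff_nonneg (m : ℕ) : 0 ≤ besselCoeff m := by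
  unfold besselCoeff
  split_ifs <;> positivity

theorem besselCoeff_le (m : ℕ) : besselCoeff m ≤ 3 ^ m / m.factorial := by
  unfold besselCoeff
  split_ifs with h
  · obtain ⟨j, rfl⟩ : ∃ j, m = 2 * j := ⟨m / 2, by omega⟩
    rw [Nat.mul_div_cancel_left _ (by norm_num)]
    have h1 : (2 * j).factorial ≤ 4 ^ j * j.factorial ^ 2 := by
      have e := Nat.choose_mul_factorial_mul_factorial (show j ≤ 2 * j by omega)
      rw [← Nat.centralBinom_eq_two_mul_choose, show 2 * j - j = j by omega] at e
      have h4 : j.centralBinom ≤ 4 ^ j := by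
        have := Nat.sum_range_choose (2 * j)
        rw [pow_mul, show 2 ^ 2 = 4 by norm_num] at this
        rw [← this, Nat.centralBinom_eq_two_mul_choose]
        exact Finset.single_le_sum (f := fun i => (2 * j).choose i) (fun _ _ => Nat.zero_le _)
          (Finset.mem_range.2 (by omega))
      calc (2 * j).factorial = j.centralBinom * j.factorial ^ 2 := by rw [← e]; ring
        _ ≤ _ := Nat.mul_le_mul_right _ h4
    have h2 : ((2 * j).factorial : ℝ) ≤ 4 ^ j * (j.factorial : ℝ) ^ 2 := by exact_mod_cast h1
    gcongr
    · norm_num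
    · omega
  · positivity

theorem summable_besselCoeff (x : ℝ) : Summable fun m => besselCoeff m * |x| ^ m := by
  refine Summable.of_nonneg_of_le (fun m => mul_nonneg (besselCoeff_nonneg m) (by positivity))
    (fun m => ?_) (Real.summable_pow_div_factorial (3 * |x|))
  calc _ ≤ 3 ^ m / m.factorial * |x| ^ m := by gcongr; exact besselCoeff_le m
    _ = _ := by rw [mul_pow]; ring

theorem besselSeries_mem (x : ℝ) : besselSeries ∈ absConvergent (x : ℂ) :=
  (summable_besselCoeff x).congr fun m => by
    rw [coeff_besselSeries, norm_mul, norm_pow, Complex.norm_real, Complex.norm_real,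
      Real.norm_of_nonneg (besselCoeff_nonneg m), Real.norm_eq_abs]

theorem evalAbsConvergent_besselSeries {x : ℝ} (hx : 0 ≤ x) :
    evalAbsConvergent x ⟨besselSeries, besselSeries_mem x⟩
      = ((∑' m, besselCoeff m * |x| ^ m : ℝ) : ℂ) := by
  rw [Complex.ofReal_tsum]
  refine tsum_congr fun m => ?_
  rw [coeff_besselSeries, abs_of_nonneg hx]
  push_cast
  rfl

theorem bessel_strictMono {x y : ℝ} (hx : 0 ≤ x) (hxy : x < y) :
    ∑' m, besselCoeff m * |x| ^ m < ∑' m, besselCoeff m * |y| ^ m := by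
  rw [abs_of_nonneg hx, abs_of_nonneg (hx.trans hxy.le)]
  have sx := summable_besselCoeff x
  have sy := summable_besselCoeff y
  rw [abs_of_nonneg hx] at sx
  rw [abs_of_nonneg (hx.trans hxy.le)] at sy
  refine Summable.tsum_lt_tsum (i := 2) (fun m => ?_) ?_ sx sy
  · exact mul_le_mul_of_nonneg_left (pow_le_pow_left₀ hx hxy.le m) (besselCoeff_nonneg m)
  · refine mul_lt_mul_of_pos_left (pow_lt_pow_left₀ hxy hx (by norm_num)) ?_
    norm_num [besselCoeff]

end Evaluation

section Independence

open Polynomial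

/-- Substitution of `besselSeries` and `expSeries` for the inner and the outer variable. -/
noncomputable def expBesselEval : ℂ[X][X] →+* PowerSeries ℂ :=
  eval₂RingHom (aeval besselSeries : ℂ[X] →ₐ[ℂ] PowerSeries ℂ).toRingHom expSeries

theorem eval_one_eq_zero_of_expBesselEval {Q : ℂ[X][X]} (hQ : expBesselEval Q = 0) :
    Q.eval 1 = 0 := by
  set x : ℕ → ℝ := fun n => 2 * Real.pi * n / Real.sqrt 3 with hx
  have hx0 : ∀ n, 0 ≤ x n := fun n => by positivity
  have hmono : StrictMono x := fun m n h => by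
    have : (m : ℝ) < n := by exact_mod_cast h
    have := Real.pi_pos
    simp only [hx]
    gcongr
  set b : ℕ → ℂ := fun n => ((∑' m, besselCoeff m * |x n| ^ m : ℝ) : ℂ) with hb
  have hinj : Function.Injective b := by
    have : StrictMono fun n => ∑' m, besselCoeff m * |x n| ^ m := fun m n h =>
      bessel_strictMono (hx0 m) (hmono h)
    exact Complex.ofReal_injective.comp this.injective
  refine Polynomial.eq_zero_of_infinite_isRoot _ ((Set.infinite_range_of_injective hinj).mono ?_)
  rintro _ ⟨n, rfl⟩
  set E : absConvergent (x n : ℂ) := ⟨expSeries, expSeries_mem _⟩ with hE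
  set B : absConvergent (x n : ℂ) := ⟨besselSeries, besselSeries_mem _⟩ with hB
  set Φ : ℂ[X][X] →+* absConvergent (x n : ℂ) :=
    eval₂RingHom (aeval B : ℂ[X] →ₐ[ℂ] absConvergent (x n : ℂ)).toRingHom E with hΦ
  have h1 : (absConvergent (x n : ℂ)).val.toRingHom.comp Φ = expBesselEval := by
    refine Polynomial.ringHom_ext' (Polynomial.ringHom_ext' ?_ ?_) ?_
    · ext a
      simp [Φ, expBesselEval]
    · simp [Φ, expBesselEval, B]
    · simp [Φ, expBesselEval, E]
  have h2 : (evalAbsConvergent (x n : ℂ)).comp Φ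
      = (evalRingHom (b n)).comp (evalRingHom 1) := by
    refine Polynomial.ringHom_ext' (Polynomial.ringHom_ext' ?_ ?_) ?_
    · ext a
      have h : ∑' j, PowerSeries.coeff j (algebraMap ℂ (PowerSeries ℂ) a) * (x n : ℂ) ^ j = a := by
        rw [tsum_eq_single 0 fun j hj => by
          rw [PowerSeries.algebraMap_apply, PowerSeries.coeff_C, if_neg hj, zero_mul]]
        simp
      simp only [Φ, RingHom.comp_apply, coe_eval₂RingHom, eval₂_C, AlgHom.toRingHom_eq_coe,
        RingHom.coe_coe, aeval_C, coe_evalRingHom, eval_C]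
      exact h
    · simp [Φ, B, evalAbsConvergent_besselSeries (hx0 n), b]
    · simp [Φ, E, evalAbsConvergent_expSeries]
      have h3 : (Real.sqrt 3 : ℂ) ≠ 0 := by
        exact_mod_cast (Real.sqrt_pos.2 (by norm_num : (0 : ℝ) < 3)).ne'
      rw [Complex.exp_eq_one_iff]
      refine ⟨n, ?_⟩
      simp only [hx]
      push_cast
      field_simp
  have h3 : Φ Q = 0 := Subtype.ext ((RingHom.congr_fun h1 Q).trans hQ)
  have h4 := RingHom.congr_fun h2 Q
  rw [RingHom.comp_apply, h3, map_zero] at h4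
  exact h4.symm

theorem expSeries_ne_one : expSeries ≠ 1 := fun h => by
  have := congrArg (PowerSeries.coeff 1) h
  simp [expSeries, PowerSeries.coeff_one] at this

theorem expBesselEval_injective : Function.Injective expBesselEval := by
  rw [injective_iff_map_eq_zero]
  suffices ∀ n, ∀ Q : ℂ[X][X], Q.natDegree ≤ n → expBesselEval Q = 0 → Q = 0 from
    fun Q => this _ Q le_rfl
  intro n
  induction n with
  | zero =>
    intro Q hd hQ
    have h := eval_one_eq_zero_of_expBesselEval hQ
    rw [eq_C_of_natDegree_le_zero hd] at h ⊢
    rw [eval_C] at h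
    rw [h, map_zero]
  | succ n ih =>
    intro Q hd hQ
    have h := eval_one_eq_zero_of_expBesselEval hQ
    obtain ⟨Q', hQ'⟩ := dvd_iff_isRoot.2 h
    by_cases h0 : Q' = 0
    · rw [hQ', h0, mul_zero]
    have hd' : Q'.natDegree ≤ n := by
      rw [hQ', natDegree_mul (X_sub_C_ne_zero 1) h0, natDegree_X_sub_C] at hd
      omega
    refine absurd (ih Q' hd' ?_) h0
    rw [hQ', map_mul] at hQ
    refine (mul_eq_zero.1 hQ).resolve_left fun h => expSeries_ne_one (sub_eq_zero.1 ?_)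
    simpa [expBesselEval] using h

theorem exp_bessel_no_relation (t : Finset (Fin 2 →₀ ℕ)) (κ : (Fin 2 →₀ ℕ) → ℂ)
    (h : ∑ m ∈ t, PowerSeries.C (κ m) * (expSeries ^ m 0 * besselSeries ^ m 1) = 0) :
    ∀ m ∈ t, κ m = 0 := by
  intro μ hμ
  have h0 : ∑ m ∈ t, C (C (κ m) * X ^ m 1) * X ^ m 0 = (0 : ℂ[X][X]) := by
    apply expBesselEval_injective
    rw [map_zero, ← h, map_sum]
    refine Finset.sum_congr rfl fun m _ => ?_
    rw [map_mul, map_pow, expBesselEval, coe_eval₂RingHom, eval₂_C, eval₂_X]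
    simp only [AlgHom.toRingHom_eq_coe, RingHom.coe_coe, map_mul, map_pow, aeval_C, aeval_X,
      PowerSeries.algebraMap_apply, Algebra.algebraMap_self, RingHom.id_apply]
    ring
  have h1 := congrArg (fun Q : ℂ[X][X] => (Q.coeff (μ 0)).coeff (μ 1)) h0
  simp only [finsetSum_coeff, coeff_C_mul, coeff_X_pow, coeff_zero] at h1
  rw [Finset.sum_eq_single μ] at h1
  · simpa using h1
  · intro m _ hm
    by_cases e0 : μ 0 = m 0
    · have e1 : μ 1 ≠ m 1 := fun e1 => hm (Finsupp.ext fun i => by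
        fin_cases i <;> simp [e0, e1])
      simp [e0, coeff_X_pow, e1]
    · simp [e0]
  · exact fun h => absurd hμ h

end Independence

section DworkLucas

open PowerSeries

variable {K Γ₀ : Type*} [Field K] [LinearOrderedCommGroupWithZero Γ₀]

theorem Valuation.natCast_le_one (v : Valuation K Γ₀) (n : ℕ) : v (n : K) ≤ 1 := by
  induction n with
  | zero => simp
  | succ n ih =>
    rw [Nat.cast_succ]
    exact v.map_add_le ih (by simp)

theorem Valuation.intCast_le_one (v : Valuation K Γ₀) (n : ℤ) : v (n : K) ≤ 1 := by
  obtain ⟨m, rfl | rfl⟩ := n.eq_nat_or_neg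
  · exact_mod_cast v.natCast_le_one m
  · rw [Int.cast_neg, v.map_neg]
    exact_mod_cast v.natCast_le_one m

theorem Valuation.intCast_lt_one (v : Valuation K Γ₀) {p : ℕ} (hv : v (p : K) < 1) {n : ℤ}
    (h : (p : ℤ) ∣ n) : v (n : K) < 1 := by
  obtain ⟨m, rfl⟩ := h
  rw [Int.cast_mul, map_mul, Int.cast_natCast]
  exact mul_lt_one_of_lt_of_le hv (v.intCast_le_one m)

theorem Valuation.dvd_of_intCast_lt_one (v : Valuation K Γ₀) {p : ℕ} (hp : p.Prime)
    (hv : v (p : K) < 1) {n : ℤ} (h : v (n : K) < 1) : (p : ℤ) ∣ n := by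
  by_contra hn
  obtain ⟨a, b, hab⟩ := ((Nat.prime_iff_prime_int.1 hp).coprime_iff_not_dvd.2 hn)
  have h1 : v ((a * p + b * n : ℤ) : K) < 1 := by
    push_cast
    refine v.map_add_lt ?_ ?_ <;> rw [map_mul]
    · exact (mul_comm _ _).trans_lt (mul_lt_one_of_lt_of_le hv (v.intCast_le_one a))
    · exact (mul_comm _ _).trans_lt (mul_lt_one_of_lt_of_le h (v.intCast_le_one b))
  rw [hab] at h1
  simp at h1

theorem Valuation.intCast_eq_one (v : Valuation K Γ₀) {p : ℕ} (hp : p.Prime)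
    (hv : v (p : K) < 1) {n : ℤ} (h : ¬ (p : ℤ) ∣ n) : v (n : K) = 1 :=
  (v.intCast_le_one n).antisymm (not_lt.1 fun hn => h (v.dvd_of_intCast_lt_one hp hv hn))

theorem Valuation.sub_mul_lt_one (v : Valuation K Γ₀) {x x' y y' : K} (hx : v (x - x') < 1)
    (hy : v (y - y') < 1) (h1 : v y ≤ 1) (h2 : v x' ≤ 1) : v (x * y - x' * y') < 1 := by
  rw [show x * y - x' * y' = (x - x') * y + x' * (y - y') by ring]
  refine v.map_add_lt ?_ ?_ <;> rw [map_mul]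
  · exact mul_lt_one_of_lt_of_le hx h1
  · exact (mul_comm _ _).trans_lt (mul_lt_one_of_lt_of_le hy h2)

theorem Valuation.le_one_of_sub_lt_one (v : Valuation K Γ₀) {x y : K} (h : v (x - y) < 1)
    (hy : v y ≤ 1) : v x ≤ 1 := by
  have := v.map_add_le h.le hy
  rwa [sub_add_cancel] at this

/-- Congruences `p ^ (n / p) * φ_n ≡ φ_{n % p} * F_{n / p}` modulo the maximal ideal of a
valuation, for indices `n < L` with `n % p < k`. -/
structure DworkLucas (v : Valuation K Γ₀) (p k L : ℕ) (φ F : K⟦X⟧) : Prop where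
  le_one : ∀ n < L, v ((p : K) ^ (n / p) * coeff n φ) ≤ 1
  sub_lt_one : ∀ n < L, n % p < k →
    v ((p : K) ^ (n / p) * coeff n φ - coeff (n % p) φ * coeff (n / p) F) < 1
  right_le_one : ∀ m, p * m < L → v (coeff m F) ≤ 1

variable {v : Valuation K Γ₀} {p k L : ℕ} {φ ψ F G : K⟦X⟧}

theorem DworkLucas.mono (h : DworkLucas v p k L φ F) {k' L' : ℕ} (hk : k' ≤ k) (hL : L' ≤ L) :
    DworkLucas v p k' L' φ F where
  le_one n hn := h.le_one n (hn.trans_le hL)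
  sub_lt_one n hn hn' := h.sub_lt_one n (hn.trans_le hL) (hn'.trans_le hk)
  right_le_one m hm := h.right_le_one m (hm.trans_le hL)

theorem DworkLucas.mod_le_one (h : DworkLucas v p k L φ F) (hp : 0 < p) {n : ℕ} (hn : n < L) :
    v (coeff (n % p) φ) ≤ 1 := by
  have := h.le_one (n % p) ((Nat.mod_le n p).trans_lt hn)
  rwa [Nat.div_eq_of_lt (Nat.mod_lt n hp), pow_zero, one_mul] at this

theorem DworkLucas.div_le_one (h : DworkLucas v p k L φ F) {n : ℕ} (hn : n < L) :
    v (coeff (n / p) F) ≤ 1 :=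
  h.right_le_one _ ((Nat.mul_div_le n p).trans_lt hn)

theorem sum_antidiagonal_no_carry {M : Type*} [AddCommMonoid M] (hp : 0 < p) (n : ℕ)
    (f : ℕ → ℕ → ℕ → ℕ → M) :
    ∑ x ∈ Finset.HasAntidiagonal.antidiagonal n with x.1 % p + x.2 % p < p,
        f (x.1 % p) (x.2 % p) (x.1 / p) (x.2 / p)
      = ∑ y ∈ Finset.HasAntidiagonal.antidiagonal (n % p) ×ˢ
          Finset.HasAntidiagonal.antidiagonal (n / p), f y.1.1 y.1.2 y.2.1 y.2.2 := by
  have key : ∀ a b c d : ℕ, a + b = n % p → c + d = n / p →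
      (p * c + a) % p = a ∧ (p * d + b) % p = b ∧ (p * c + a) / p = c ∧ (p * d + b) / p = d := by
    intro a b c d hab _
    have := Nat.mod_lt n hp
    have ha : a < p := by omega
    have hb : b < p := by omega
    refine ⟨?_, ?_, ?_, ?_⟩
    · rw [Nat.mul_add_mod, Nat.mod_eq_of_lt ha]
    · rw [Nat.mul_add_mod, Nat.mod_eq_of_lt hb]
    · rw [Nat.mul_add_div hp, Nat.div_eq_of_lt ha, add_zero]
    · rw [Nat.mul_add_div hp, Nat.div_eq_of_lt hb, add_zero]
  refine Finset.sum_nbij' (fun x => ((x.1 % p, x.2 % p), (x.1 / p, x.2 / p)))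
    (fun y => (p * y.2.1 + y.1.1, p * y.2.2 + y.1.2)) ?_ ?_ ?_ ?_ fun _ _ => rfl
  · rintro ⟨i, j⟩ h
    rw [Finset.mem_filter, Finset.HasAntidiagonal.mem_antidiagonal] at h
    obtain ⟨h, hc⟩ := h
    simp only at h hc
    simp only [Finset.mem_product, Finset.HasAntidiagonal.mem_antidiagonal]
    subst h
    exact ⟨by rw [Nat.add_mod, Nat.mod_eq_of_lt hc], by rw [Nat.add_div_eq_of_add_mod_lt hc]⟩
  · rintro ⟨⟨a, b⟩, c, d⟩ h
    simp only [Finset.mem_product, Finset.HasAntidiagonal.mem_antidiagonal] at h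
    obtain ⟨k1, k2, -, -⟩ := key a b c d h.1 h.2
    simp only [Finset.mem_filter, Finset.HasAntidiagonal.mem_antidiagonal, k1, k2]
    refine ⟨?_, h.1 ▸ Nat.mod_lt n hp⟩
    calc _ = p * (c + d) + (a + b) := by ring
      _ = n := by rw [h.1, h.2, Nat.div_add_mod]
  · rintro ⟨i, j⟩ _
    simp only [Nat.div_add_mod]
  · rintro ⟨⟨a, b⟩, c, d⟩ h
    simp only [Finset.mem_product, Finset.HasAntidiagonal.mem_antidiagonal] at h
    obtain ⟨k1, k2, k3, k4⟩ := key a b c d h.1 h.2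
    simp only [k1, k2, k3, k4]

theorem DworkLucas.mul (hp : 0 < p) (hv : v (p : K) < 1)
    (hφ : DworkLucas v p k L φ F) (hψ : DworkLucas v p k L ψ G) :
    DworkLucas v p k L (φ * ψ) (F * G) := by
  have hcarry : ∀ n < L, ∀ x ∈ Finset.HasAntidiagonal.antidiagonal n, ¬ x.1 % p + x.2 % p < p →
      v ((p : K) ^ (n / p) * (coeff x.1 φ * coeff x.2 ψ)) < 1 := by
    rintro n hn ⟨i, j⟩ hx hc
    rw [Finset.HasAntidiagonal.mem_antidiagonal] at hx
    simp only at hx hc ⊢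
    rw [← hx, Nat.add_div hp, if_pos (not_lt.1 hc),
      show (p : K) ^ (i / p + j / p + 1) * (coeff i φ * coeff j ψ)
        = p * ((p ^ (i / p) * coeff i φ) * (p ^ (j / p) * coeff j ψ)) by ring, map_mul, map_mul]
    exact mul_lt_one_of_lt_of_le hv
      (mul_le_one' (hφ.le_one i (by omega)) (hψ.le_one j (by omega)))
  have hno : ∀ n < L, ∀ x ∈ Finset.HasAntidiagonal.antidiagonal n, x.1 % p + x.2 % p < p →
      (p : K) ^ (n / p) * (coeff x.1 φ * coeff x.2 ψ)
        = (p ^ (x.1 / p) * coeff x.1 φ) * (p ^ (x.2 / p) * coeff x.2 ψ) := by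
    rintro n hn ⟨i, j⟩ hx hc
    rw [Finset.HasAntidiagonal.mem_antidiagonal] at hx
    simp only at hx hc ⊢
    rw [← hx, Nat.add_div_eq_of_add_mod_lt hc]
    ring
  refine ⟨fun n hn => ?_, fun n hn hnk => ?_, fun m hm => ?_⟩
  · rw [coeff_mul, Finset.mul_sum]
    refine v.map_sum_le fun x hx => ?_
    by_cases hc : x.1 % p + x.2 % p < p
    · rw [hno n hn x hx hc, map_mul]
      rw [Finset.HasAntidiagonal.mem_antidiagonal] at hx
      exact mul_le_one' (hφ.le_one _ (by omega)) (hψ.le_one _ (by omega))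
    · exact (hcarry n hn x hx hc).le
  · have e : coeff (n % p) (φ * ψ) * coeff (n / p) (F * G)
        = ∑ x ∈ Finset.HasAntidiagonal.antidiagonal n, if x.1 % p + x.2 % p < p then
            (coeff (x.1 % p) φ * coeff (x.1 / p) F) * (coeff (x.2 % p) ψ * coeff (x.2 / p) G)
          else 0 := by
      rw [← Finset.sum_filter, sum_antidiagonal_no_carry hp n fun a b c d =>
        (coeff a φ * coeff c F) * (coeff b ψ * coeff d G), coeff_mul, coeff_mul,
        Finset.sum_mul_sum, Finset.sum_product]
      exact Finset.sum_congr rfl fun _ _ => Finset.sum_congr rfl fun _ _ => by ring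
    rw [e, coeff_mul, Finset.mul_sum, ← Finset.sum_sub_distrib]
    refine v.map_sum_lt one_ne_zero fun x hx => ?_
    split_ifs with hc
    · rw [hno n hn x hx hc]
      rw [Finset.HasAntidiagonal.mem_antidiagonal] at hx
      have hm : x.1 % p + x.2 % p = n % p := by rw [← hx, Nat.add_mod, Nat.mod_eq_of_lt hc]
      have h1 : x.1 < L := by omega
      have h2 : x.2 < L := by omega
      refine v.sub_mul_lt_one (hφ.sub_lt_one _ h1 (by omega)) (hψ.sub_lt_one _ h2 (by omega))
        (hψ.le_one _ h2) ?_
      rw [map_mul]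
      exact mul_le_one' (hφ.mod_le_one hp h1) (hφ.div_le_one h1)
    · rw [sub_zero]
      exact hcarry n hn x hx hc
  · rw [coeff_mul]
    refine v.map_sum_le fun x hx => ?_
    rw [Finset.HasAntidiagonal.mem_antidiagonal] at hx
    rw [map_mul]
    refine mul_le_one' (hφ.right_le_one _ ?_) (hψ.right_le_one _ ?_) <;>
      exact (Nat.mul_le_mul_left p (by omega)).trans_lt hm

theorem dworkLucas_one_right (hv : v (p : K) < 1) (h : ∀ n, v (coeff n φ) ≤ 1) :
    DworkLucas v p k L φ 1 where
  le_one n _ := by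
    rw [map_mul, map_pow]
    exact mul_le_one' (pow_le_one' hv.le _) (h n)
  sub_lt_one n _ _ := by
    rw [coeff_one]
    split_ifs with h0
    · have hn : n % p = n := by
        rcases Nat.div_eq_zero_iff.1 h0 with rfl | h'
        · exact Nat.mod_zero n
        · exact Nat.mod_eq_of_lt h'
      rw [h0, hn]
      simp
    · rw [mul_zero, sub_zero, map_mul, map_pow]
      exact mul_lt_one_of_lt_of_le (pow_lt_one₀ zero_le hv h0) (h n)
  right_le_one m _ := by
    rw [coeff_one]
    split_ifs <;> simp

theorem DworkLucas.pow (hp : 0 < p) (hv : v (p : K) < 1)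
    (hφ : DworkLucas v p k L φ F) (n : ℕ) : DworkLucas v p k L (φ ^ n) (F ^ n) := by
  induction n with
  | zero =>
    rw [pow_zero, pow_zero]
    refine dworkLucas_one_right hv fun n => ?_
    rw [coeff_one]
    split_ifs <;> simp
  | succ n ih =>
    rw [pow_succ, pow_succ]
    exact ih.mul hp hv hφ

theorem DworkLucas.derivative (hp : 0 < p) (hv : v (p : K) < 1) (hkp : k + 1 ≤ p)
    (h : DworkLucas v p (k + 1) (L + 1) φ F) :
    DworkLucas v p k L (PowerSeries.derivative K φ) F where
  le_one n hn := by
    have h1 := h.le_one (n + 1) (by omega)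
    rw [coeff_derivative]
    by_cases hd : p ∣ n + 1
    · rw [Nat.succ_div_of_dvd hd] at h1
      obtain ⟨q, hq⟩ := hd
      have hq' : (n : K) + 1 = p * q := by exact_mod_cast congrArg (Nat.cast (R := K)) hq
      rw [hq', show (p : K) ^ (n / p) * (coeff (n + 1) φ * (p * q))
        = q * (p ^ (n / p + 1) * coeff (n + 1) φ) by ring, map_mul]
      exact mul_le_one' (v.natCast_le_one q) h1
    · rw [Nat.succ_div_of_not_dvd hd] at h1
      rw [← mul_assoc, map_mul]
      exact mul_le_one' h1 (by exact_mod_cast v.natCast_le_one (n + 1))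
  sub_lt_one n hn hnk := by
    have hmod : (n + 1) % p = n % p + 1 := by
      rw [Nat.add_mod, Nat.mod_eq_of_lt (show 1 < p by omega), Nat.mod_eq_of_lt (by omega)]
    have hdiv : (n + 1) / p = n / p := by
      rw [Nat.add_div_eq_of_add_mod_lt, Nat.div_eq_of_lt (show 1 < p by omega), add_zero]
      rw [Nat.mod_eq_of_lt (show 1 < p by omega)]
      omega
    have h1 := h.sub_lt_one (n + 1) (by omega) (by omega)
    have h2 := h.mod_le_one hp (n := n + 1) (by omega)
    have h3 := h.div_le_one (n := n + 1) (by omega)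
    rw [hdiv] at h1 h3
    rw [hmod] at h1 h2
    have hn' : (n : K) = p * (n / p : ℕ) + (n % p : ℕ) := by
      exact_mod_cast congrArg (Nat.cast (R := K)) (Nat.div_add_mod n p).symm
    rw [coeff_derivative, coeff_derivative,
      show (p : K) ^ (n / p) * (coeff (n + 1) φ * (n + 1))
          - coeff (n % p + 1) φ * ((n % p : ℕ) + 1) * coeff (n / p) F
        = ((n + 1 : ℕ) : K) * (p ^ (n / p) * coeff (n + 1) φ - coeff (n % p + 1) φ * coeff (n / p) F)
          + p * ((n / p : ℕ) * (coeff (n % p + 1) φ * coeff (n / p) F)) by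
        push_cast
        linear_combination coeff (n % p + 1) φ * coeff (n / p) F * hn']
    refine v.map_add_lt ?_ ?_ <;> rw [map_mul]
    · exact (mul_comm _ _).trans_lt (mul_lt_one_of_lt_of_le h1 (v.natCast_le_one _))
    · refine mul_lt_one_of_lt_of_le hv ?_
      rw [map_mul, map_mul]
      exact mul_le_one' (v.natCast_le_one _) (mul_le_one' h2 h3)
  right_le_one m hm := h.right_le_one m (by omega)

theorem DworkLucas.iterate_derivative (hp : 0 < p) (hv : v (p : K) < 1) (r : ℕ) :
    ∀ {k L : ℕ}, k + r ≤ p → DworkLucas v p (k + r) (L + r) φ F →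
      DworkLucas v p k L ((fun f => PowerSeries.derivative K f)^[r] φ) F := by
  induction r with
  | zero => exact fun _ h => h
  | succ r ih =>
    intro k L hk h
    rw [Function.iterate_succ_apply']
    refine DworkLucas.derivative hp hv (by omega) (ih (by omega) ?_)
    rwa [show k + 1 + r = k + (r + 1) by ring, show L + 1 + r = L + (r + 1) by ring]

end DworkLucas

theorem exists_factorial_eq_prime_pow_mul {p : ℕ} (hp : p.Prime) (m r : ℕ) (hr : r < p) :
    ∃ w : ℤ, (((p * m + r).factorial : ℕ) : ℤ) = p ^ m * w ∧
      (p : ℤ) ∣ w - (-1) ^ m * (m.factorial * r.factorial) := by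
  have := Fact.mk hp
  have step : ∀ m, (∃ w : ℤ, (((p * m).factorial : ℕ) : ℤ) = p ^ m * w ∧
      (p : ℤ) ∣ w - (-1) ^ m * m.factorial) → ∀ r < p,
      ∃ w : ℤ, (((p * m + r).factorial : ℕ) : ℤ) = p ^ m * w ∧
      (p : ℤ) ∣ w - (-1) ^ m * (m.factorial * r.factorial) := by
    rintro m h0 r hr
    induction r with
    | zero => simpa using h0
    | succ r ih =>
      obtain ⟨w, hw, c, hc⟩ := ih (by omega)
      refine ⟨(p * m + r + 1) * w, ?_, m * w + (r + 1) * c, ?_⟩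
      · rw [← add_assoc, Nat.factorial_succ]
        push_cast at hw ⊢
        rw [hw]
        ring
      · rw [Nat.factorial_succ]
        push_cast
        linear_combination (r + 1 : ℤ) * hc
  have base : ∀ m, ∃ w : ℤ, (((p * m).factorial : ℕ) : ℤ) = p ^ m * w ∧
      (p : ℤ) ∣ w - (-1) ^ m * m.factorial := by
    intro m
    induction m with
    | zero => exact ⟨1, by simp, by simp⟩
    | succ m ih =>
      obtain ⟨w, hw, c, hc⟩ := step m ih (p - 1) (Nat.sub_lt hp.pos one_pos)
      obtain ⟨d, hd⟩ : (p : ℤ) ∣ (p - 1).factorial + 1 := by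
        rw [← ZMod.intCast_zmod_eq_zero_iff_dvd]
        push_cast
        rw [ZMod.wilsons_lemma]
        ring
      refine ⟨(m + 1) * w, ?_, (m + 1) * (c + (-1) ^ m * m.factorial * d), ?_⟩
      · rw [show p * (m + 1) = p * m + (p - 1) + 1 by have := hp.pos; rw [mul_add]; omega,
          Nat.factorial_succ, show p * m + (p - 1) + 1 = p * (m + 1) by
            have := hp.pos; rw [mul_add]; omega]
        push_cast at hw ⊢
        rw [hw]
        ring
      · rw [Nat.factorial_succ]
        push_cast
        linear_combination (m + 1 : ℤ) * hc + (m + 1 : ℤ) * (-1) ^ m * m.factorial * hd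
  exact step m (base m) r hr

section Valuation

variable {K Γ₀ : Type*} [Field K] [LinearOrderedCommGroupWithZero Γ₀] (v : Valuation K Γ₀)

theorem Valuation.pow_sub_pow_lt_one {x y : K} (h : v (x - y) < 1) (hy : v y ≤ 1) (n : ℕ) :
    v (x ^ n - y ^ n) < 1 := by
  induction n with
  | zero => simp
  | succ n ih =>
    rw [pow_succ, pow_succ]
    refine v.sub_mul_lt_one ih h (v.le_one_of_sub_lt_one h hy) ?_
    rw [map_pow]
    exact pow_le_one' hy n

theorem Valuation.inv_sub_inv_lt_one {x y : K} (hx : v x = 1) (hy : v y = 1)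
    (h : v (x - y) < 1) : v (x⁻¹ - y⁻¹) < 1 := by
  have hx0 : x ≠ 0 := v.ne_zero_iff.1 (by rw [hx]; exact one_ne_zero)
  have hy0 : y ≠ 0 := v.ne_zero_iff.1 (by rw [hy]; exact one_ne_zero)
  rw [inv_sub_inv hx0 hy0, map_div₀, map_mul, hx, hy, v.map_sub_swap, mul_one, div_one]
  exact h

variable {v} {p : ℕ}

theorem valuation_factorial (hp : p.Prime) (hv : v (p : K) < 1) {n : ℕ} (hn : n < p) :
    v (n.factorial : K) = 1 := by
  have h := v.intCast_eq_one hp hv (n := n.factorial) (by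
    rw [Int.natCast_dvd_natCast, hp.dvd_factorial]
    omega)
  exact_mod_cast h

theorem exists_valuation_factorial (hp : p.Prime) (hv : v (p : K) < 1) {m r : ℕ} (hm : m < p)
    (hr : r < p) : ∃ w : K, (((p * m + r).factorial : ℕ) : K) = p ^ m * w ∧ v w = 1 ∧
      v ((-1) ^ m * (m.factorial * r.factorial) : K) = 1 ∧
      v (w - (-1) ^ m * (m.factorial * r.factorial)) < 1 := by
  obtain ⟨w, hw, hd⟩ := exists_factorial_eq_prime_pow_mul hp m r hr
  have h1 : v ((-1) ^ m * (m.factorial * r.factorial) : K) = 1 := by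
    rw [map_mul, map_pow, v.map_neg, map_one, one_pow, one_mul, map_mul,
      valuation_factorial hp hv hm, valuation_factorial hp hv hr, one_mul]
  have h2 : v ((w : K) - (-1) ^ m * (m.factorial * r.factorial)) < 1 := by
    have := v.intCast_lt_one hv hd
    push_cast at this
    exact this
  refine ⟨w, by exact_mod_cast congrArg (Int.cast (R := K)) hw, ?_, h1, h2⟩
  have := v.map_add_eq_of_lt_right (h2.trans_eq h1.symm)
  rwa [sub_add_cancel, h1] at this

end Valuation

section ExpBessel

open PowerSeries

variable {Γ₀ : Type*} [LinearOrderedCommGroupWithZero Γ₀] {v : Valuation ℂ Γ₀} {p : ℕ}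

theorem sqrt_three_mul_I_sq : ((Real.sqrt 3 : ℂ) * Complex.I) ^ 2 = ((-3 : ℤ) : ℂ) := by
  rw [mul_pow, Complex.I_sq, ← Complex.ofReal_pow, Real.sq_sqrt (by norm_num)]
  push_cast
  ring

theorem valuation_sqrt_three_mul_I_le_one (v : Valuation ℂ Γ₀) :
    v ((Real.sqrt 3 : ℂ) * Complex.I) ≤ 1 := by
  have h := v.intCast_le_one (-3)
  rw [← sqrt_three_mul_I_sq, map_pow] at h
  exact (pow_le_one_iff two_ne_zero).1 h

theorem exists_sign_sqrt_three_mul_I_pow (hp : p.Prime) (hp3 : 3 < p) (hv : v (p : ℂ) < 1) :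
    ∃ ε : ℂ, (ε = 1 ∨ ε = -1) ∧ v (((Real.sqrt 3 : ℂ) * Complex.I) ^ (p - 1) - ε) < 1 := by
  have := Fact.mk hp
  set u := ((Real.sqrt 3 : ℂ) * Complex.I) ^ (p - 1)
  have hd : (p : ℤ) ∣ (-3) ^ (p - 1) - 1 := by
    rw [← ZMod.intCast_zmod_eq_zero_iff_dvd]
    push_cast
    rw [ZMod.pow_card_sub_one_eq_one, sub_self]
    have : ((3 : ℕ) : ZMod p) ≠ 0 := by
      rw [Ne, ZMod.natCast_eq_zero_iff]
      exact Nat.not_dvd_of_pos_of_lt (by norm_num) hp3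
    exact neg_ne_zero.2 (by exact_mod_cast this)
  have h := v.intCast_lt_one hv hd
  have e : (((-3) ^ (p - 1) - 1 : ℤ) : ℂ) = (u - 1) * (u - -1) := by
    rw [Int.cast_sub, Int.cast_pow, ← sqrt_three_mul_I_sq, ← pow_mul, mul_comm 2, pow_mul]
    push_cast
    ring
  rw [e, map_mul] at h
  by_cases h1 : v (u - 1) < 1
  · exact ⟨1, Or.inl rfl, h1⟩
  · refine ⟨-1, Or.inr rfl, not_le.1 fun h2 => h.not_ge ?_⟩
    exact one_le_mul (not_lt.1 h1) h2

theorem exists_dworkLucas_expSeries (hp : p.Prime) (hp3 : 3 < p) (hv : v (p : ℂ) < 1) :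
    ∃ s : ℂ, (s = 1 ∨ s = -1) ∧
      DworkLucas v p p (p * p) expSeries (rescale s expSeries) := by
  obtain ⟨ε, hε, hu⟩ := exists_sign_sqrt_three_mul_I_pow hp hp3 hv
  have hα := valuation_sqrt_three_mul_I_le_one v
  have hp0 : (p : ℂ) ≠ 0 := by exact_mod_cast hp.ne_zero
  have hvε : v ε = 1 := by rcases hε with rfl | rfl <;> simp
  have coeff_exp : ∀ n, coeff n expSeries
      = ((Real.sqrt 3 : ℂ) * Complex.I) ^ n / (n.factorial : ℂ) := fun n => coeff_mk _ _
  set α := (Real.sqrt 3 : ℂ) * Complex.I with hαdef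
  set u := α ^ (p - 1) with hudef
  have hvu : v u ≤ 1 := by
    rw [hudef, map_pow]
    exact pow_le_one' hα _
  have hvα : ∀ r m, v (α ^ r * α ^ m) ≤ 1 := fun r m => by
    rw [← pow_add, map_pow]
    exact pow_le_one' hα _
  have key : ∀ n < p * p, ∃ w w' : ℂ, v w = 1 ∧ v w' = 1 ∧ v (w - w') < 1 ∧
      (p : ℂ) ^ (n / p) * coeff n expSeries
        = (α ^ (n % p) * α ^ (n / p)) * (u ^ (n / p) * w⁻¹) ∧
      coeff (n % p) expSeries * coeff (n / p) (rescale (-ε) expSeries)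
        = (α ^ (n % p) * α ^ (n / p)) * (ε ^ (n / p) * w'⁻¹) := by
    intro n hn
    obtain ⟨w, hw, h1, h2, h3⟩ := exists_valuation_factorial hp hv
      (Nat.div_lt_of_lt_mul hn) (Nat.mod_lt n hp.pos)
    have hw0 : w ≠ 0 := v.ne_zero_iff.1 (by rw [h1]; exact one_ne_zero)
    rw [Nat.div_add_mod] at hw
    refine ⟨w, _, h1, h2, h3, ?_, ?_⟩
    · have e : α ^ n = α ^ (n % p) * α ^ (n / p) * u ^ (n / p) := by
        rw [hudef, ← pow_mul, ← pow_add, ← pow_add]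
        congr 1
        conv_lhs => rw [← Nat.div_add_mod n p]
        obtain ⟨q, rfl⟩ : ∃ q, p = q + 1 := ⟨p - 1, by omega⟩
        rw [Nat.add_sub_cancel]
        ring
      rw [coeff_exp, hw, e]
      field_simp
    · rw [coeff_rescale, coeff_exp, coeff_exp, neg_eq_neg_one_mul, mul_pow, mul_inv, mul_inv,
        ← inv_pow, inv_neg_one]
      ring
  refine ⟨-ε, by rcases hε with rfl | rfl <;> simp, fun n hn => ?_, fun n hn _ => ?_,
    fun m hm => ?_⟩
  · obtain ⟨w, w', h1, h2, h3, h4, -⟩ := key n hn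
    rw [h4, map_mul, map_mul v (u ^ _), map_inv₀, h1, inv_one, mul_one, map_pow]
    exact mul_le_one' (hvα _ _) (pow_le_one' hvu _)
  · obtain ⟨w, w', h1, h2, h3, h4, h5⟩ := key n hn
    rw [h4, h5, ← mul_sub, map_mul]
    refine (mul_comm _ _).trans_lt (mul_lt_one_of_lt_of_le ?_ (hvα _ _))
    refine v.sub_mul_lt_one (v.pow_sub_pow_lt_one hu hvε.le _) (v.inv_sub_inv_lt_one h1 h2 h3) ?_ ?_
    · rw [map_inv₀, h1, inv_one]
    · rw [map_pow, hvε, one_pow]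
  · have hm' : m < p := Nat.lt_of_mul_lt_mul_left hm
    rw [coeff_rescale, coeff_exp, map_mul, map_pow, v.map_neg, hvε, one_pow, one_mul, map_div₀,
      valuation_factorial hp hv hm', div_one, map_pow]
    exact pow_le_one' hα _

theorem coeff_two_mul_besselSeries (j : ℕ) :
    coeff (2 * j) besselSeries = (3 / 4) ^ j * ((j.factorial : ℂ) ^ 2)⁻¹ := by
  rw [besselSeries, coeff_mk, if_pos (by omega), Nat.mul_div_cancel_left _ two_pos, div_pow,
    ← div_div, div_eq_mul_inv]

theorem coeff_besselSeries_of_odd {n : ℕ} (hn : n % 2 = 1) : coeff n besselSeries = 0 := by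
  rw [besselSeries, coeff_mk, if_neg (by omega)]

theorem valuation_four (hp : p.Prime) (hp3 : 3 < p) (hv : v (p : ℂ) < 1) : v (4 : ℂ) = 1 := by
  have h2 : v (2 : ℂ) = 1 := by
    have := v.intCast_eq_one hp hv (n := 2) fun h => by
      have := Int.le_of_dvd (by norm_num) h
      omega
    exact_mod_cast this
  rw [show (4 : ℂ) = 2 * 2 by norm_num, map_mul, h2, one_mul]

theorem valuation_three_quarters_le_one (hp : p.Prime) (hp3 : 3 < p) (hv : v (p : ℂ) < 1) :
    v (3 / 4 : ℂ) ≤ 1 := by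
  rw [map_div₀, valuation_four hp hp3 hv, div_one]
  exact_mod_cast v.natCast_le_one 3

theorem valuation_three_quarters_pow_sub (hp : p.Prime) (hp3 : 3 < p) (hv : v (p : ℂ) < 1) :
    v ((3 / 4 : ℂ) ^ p - 3 / 4) < 1 := by
  have := Fact.mk hp
  have h4 := valuation_four hp hp3 hv
  have fermat : ∀ a : ℤ, v ((a : ℂ) ^ p - a) < 1 := fun a => by
    have hd : (p : ℤ) ∣ a ^ p - a := by
      rw [← ZMod.intCast_zmod_eq_zero_iff_dvd]
      push_cast
      rw [ZMod.pow_card, sub_self]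
    have := v.intCast_lt_one hv hd
    push_cast at this
    exact this
  rw [div_pow, div_eq_mul_inv, div_eq_mul_inv]
  refine v.sub_mul_lt_one ?_ (v.inv_sub_inv_lt_one ?_ h4 ?_) ?_ ?_
  · exact_mod_cast fermat 3
  · rw [map_pow, h4, one_pow]
  · exact_mod_cast fermat 4
  · rw [map_inv₀, map_pow, h4, one_pow, inv_one]
  · exact_mod_cast v.natCast_le_one 3

theorem dworkLucas_besselSeries (hp : p.Prime) (hp3 : 3 < p) (hv : v (p : ℂ) < 1) :
    DworkLucas v p p (p * p) besselSeries besselSeries := by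
  have ht := valuation_three_quarters_le_one hp hp3 hv
  have ht' := valuation_three_quarters_pow_sub hp hp3 hv
  have hp0 : (p : ℂ) ≠ 0 := by exact_mod_cast hp.ne_zero
  obtain ⟨q, hq⟩ : ∃ q, p = 2 * q + 1 := hp.odd_of_ne_two (by omega)
  have key : ∀ n < p * p, v ((p : ℂ) ^ (n / p) * coeff n besselSeries) ≤ 1 ∧
      v ((p : ℂ) ^ (n / p) * coeff n besselSeries
        - coeff (n % p) besselSeries * coeff (n / p) besselSeries) < 1 := by
    intro n hn
    have hm := Nat.div_lt_of_lt_mul hn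
    have hr := Nat.mod_lt n hp.pos
    have hn' := Nat.div_add_mod n p
    generalize n / p = m at *
    generalize n % p = r at *
    subst hn'
    have hpar : (p * m + r) % 2 = (m + r) % 2 := by
      rw [hq, show (2 * q + 1) * m + r = 2 * (q * m) + (m + r) by ring, Nat.mul_add_mod]
    by_cases hodd : (m + r) % 2 = 1
    · have h0 : coeff r besselSeries * coeff m besselSeries = 0 := by
        rcases Nat.mod_two_eq_zero_or_one r with h | h
        · rw [coeff_besselSeries_of_odd (n := m) (by omega), mul_zero]
        · rw [coeff_besselSeries_of_odd h, zero_mul]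
      rw [coeff_besselSeries_of_odd (n := p * m + r) (by omega), h0]
      simp
    rcases Nat.mod_two_eq_zero_or_one r with hr2 | hr2
    · obtain ⟨a, rfl⟩ : ∃ a, r = 2 * a := ⟨r / 2, by omega⟩
      obtain ⟨b, rfl⟩ : ∃ b, m = 2 * b := ⟨m / 2, by omega⟩
      obtain ⟨w, hw, h1, h2, h3⟩ := exists_valuation_factorial hp hv (m := b) (r := a)
        (by omega) (by omega)
      have hw0 : w ≠ 0 := v.ne_zero_iff.1 (by rw [h1]; exact one_ne_zero)
      have e1 : (p : ℂ) ^ (2 * b) * coeff (p * (2 * b) + 2 * a) besselSeries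
          = (3 / 4) ^ a * (((3 / 4) ^ p) ^ b * (w⁻¹) ^ 2) := by
        rw [show p * (2 * b) + 2 * a = 2 * (p * b + a) by ring, coeff_two_mul_besselSeries, hw]
        field_simp
        ring
      have e2 : coeff (2 * a) besselSeries * coeff (2 * b) besselSeries
          = (3 / 4) ^ a * ((3 / 4) ^ b * (((-1) ^ b * (b.factorial * a.factorial) : ℂ)⁻¹) ^ 2) := by
        rw [coeff_two_mul_besselSeries, coeff_two_mul_besselSeries, inv_pow, mul_pow, ← pow_mul,
          mul_comm b 2, pow_mul, neg_one_sq, one_pow, one_mul, mul_pow, mul_inv]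
        ring
      have h5 : v (w⁻¹ ^ 2) ≤ 1 := by rw [map_pow, map_inv₀, h1, inv_one, one_pow]
      rw [e1, e2]
      refine ⟨?_, ?_⟩
      · rw [map_mul, map_mul, map_pow, map_pow, map_pow]
        exact mul_le_one' (pow_le_one' ht _) (mul_le_one' (pow_le_one' (pow_le_one' ht _) _) h5)
      · rw [← mul_sub, map_mul]
        refine (mul_comm _ _).trans_lt (mul_lt_one_of_lt_of_le ?_ ?_)
        · refine v.sub_mul_lt_one (v.pow_sub_pow_lt_one ht' ht _)
            (v.pow_sub_pow_lt_one (v.inv_sub_inv_lt_one h1 h2 h3) ?_ _) h5 ?_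
          · rw [map_inv₀, h2, inv_one]
          · rw [map_pow]
            exact pow_le_one' ht _
        · rw [map_pow]
          exact pow_le_one' ht _
    · obtain ⟨a, rfl⟩ : ∃ a, r = 2 * a + 1 := ⟨r / 2, by omega⟩
      obtain ⟨b, rfl⟩ : ∃ b, m = 2 * b + 1 := ⟨m / 2, by omega⟩
      obtain ⟨w, hw, h1, -, -⟩ := exists_valuation_factorial hp hv (m := b) (r := q + a + 1)
        (by omega) (by omega)
      have hw0 : w ≠ 0 := v.ne_zero_iff.1 (by rw [h1]; exact one_ne_zero)
      have e1 : (p : ℂ) ^ (2 * b + 1) * coeff (p * (2 * b + 1) + (2 * a + 1)) besselSeries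
          = p * ((3 / 4) ^ (p * b + (q + a + 1)) * (w⁻¹) ^ 2) := by
        rw [show p * (2 * b + 1) + (2 * a + 1) = 2 * (p * b + (q + a + 1)) by rw [hq]; ring,
          coeff_two_mul_besselSeries, hw]
        field_simp
        ring
      have h5 : v ((p : ℂ) * ((3 / 4) ^ (p * b + (q + a + 1)) * (w⁻¹) ^ 2)) < 1 := by
        rw [map_mul, map_mul, map_pow, map_pow, map_inv₀, h1, inv_one, one_pow, mul_one]
        exact mul_lt_one_of_lt_of_le hv (pow_le_one' ht _)
      rw [e1, coeff_besselSeries_of_odd hr2, zero_mul, sub_zero]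
      exact ⟨h5.le, h5⟩
  refine ⟨fun n hn => (key n hn).1, fun n hn _ => (key n hn).2, fun m hm => ?_⟩
  have hm' : m < p := Nat.lt_of_mul_lt_mul_left hm
  rcases Nat.mod_two_eq_zero_or_one m with h | h
  · obtain ⟨b, rfl⟩ : ∃ b, m = 2 * b := ⟨m / 2, by omega⟩
    rw [coeff_two_mul_besselSeries, map_mul, map_inv₀, map_pow, map_pow,
      valuation_factorial hp hv (by omega), one_pow, inv_one, mul_one]
    exact pow_le_one' ht _
  · rw [coeff_besselSeries_of_odd h, map_zero]
    exact zero_le_one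

end ExpBessel

section GloballyBounded

open PowerSeries Filter

/-- Power series whose coefficients lie in a given subring. -/
def coeffSubring {R : Type*} [CommRing R] (A : Subring R) : Subring (PowerSeries R) where
  carrier := {φ | ∀ n, coeff n φ ∈ A}
  mul_mem' hφ hψ n := by
    rw [coeff_mul]
    exact A.sum_mem fun x _ => A.mul_mem (hφ x.1) (hψ x.2)
  one_mem' n := by
    rw [coeff_one]
    split_ifs
    exacts [A.one_mem, A.zero_mem]
  add_mem' hφ hψ n := by
    rw [map_add]
    exact A.add_mem (hφ n) (hψ n)
  zero_mem' n := by
    rw [map_zero]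
    exact A.zero_mem
  neg_mem' hφ n := by
    rw [map_neg]
    exact A.neg_mem (hφ n)

theorem derivative_mem_coeffSubring {R : Type*} [CommRing R] {A : Subring R} {φ : PowerSeries R}
    (h : φ ∈ coeffSubring A) : derivative R φ ∈ coeffSubring A := fun n => by
  rw [coeff_derivative]
  exact A.mul_mem (h _) (by exact_mod_cast natCast_mem A (n + 1))

theorem iterate_derivative_mem_coeffSubring {R : Type*} [CommRing R] {A : Subring R}
    {φ : PowerSeries R} (h : φ ∈ coeffSubring A) (r : ℕ) :
    (fun f => derivative R f)^[r] φ ∈ coeffSubring A := by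
  induction r with
  | zero => exact h
  | succ r ih =>
    rw [Function.iterate_succ_apply']
    exact derivative_mem_coeffSubring ih

/-- Complex power series with algebraic coefficients. -/
noncomputable abbrev algebraicCoeffs : Subring (PowerSeries ℂ) :=
  coeffSubring (algebraicClosure ℚ ℂ).toSubring

/-- Complex power series with algebraic coefficients that are integral at every valuation subring
above every large prime. -/
noncomputable def globallyBounded : Subring (PowerSeries ℂ) where
  carrier := {φ | φ ∈ algebraicCoeffs ∧ ∀ᶠ p : ℕ in atTop, p.Prime → ∀ V : ValuationSubring ℂ,
    V.valuation (p : ℂ) < 1 → φ ∈ coeffSubring V.toSubring}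
  mul_mem' hφ hψ := ⟨mul_mem hφ.1 hψ.1, by
    filter_upwards [hφ.2, hψ.2] with p h1 h2 hp V hV
    exact mul_mem (h1 hp V hV) (h2 hp V hV)⟩
  one_mem' := ⟨one_mem _, Eventually.of_forall fun _ _ _ _ => one_mem _⟩
  add_mem' hφ hψ := ⟨add_mem hφ.1 hψ.1, by
    filter_upwards [hφ.2, hψ.2] with p h1 h2 hp V hV
    exact add_mem (h1 hp V hV) (h2 hp V hV)⟩
  zero_mem' := ⟨zero_mem _, Eventually.of_forall fun _ _ _ _ => zero_mem _⟩
  neg_mem' hφ := ⟨neg_mem hφ.1, by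
    filter_upwards [hφ.2] with p h1 hp V hV
    exact neg_mem (h1 hp V hV)⟩

theorem iterate_derivative_mem_globallyBounded {φ : PowerSeries ℂ} (h : φ ∈ globallyBounded)
    (r : ℕ) : (fun f => derivative ℂ f)^[r] φ ∈ globallyBounded := by
  refine ⟨iterate_derivative_mem_coeffSubring h.1 r, ?_⟩
  filter_upwards [h.2] with p h1 hp V hV
  exact iterate_derivative_mem_coeffSubring (h1 hp V hV) r

theorem exists_valuationSubring_prime {p : ℕ} (hp : p.Prime) :
    ∃ V : ValuationSubring ℂ, V.valuation (p : ℂ) < 1 := by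
  set A : Subring ℂ := (Int.castRingHom ℂ).range
  have hinj : Function.Injective (Int.castRingHom ℂ) := (Int.castRingHom ℂ).injective_int
  have htop : Ideal.span {(p : A)} ≠ ⊤ := by
    rw [Ne, Ideal.span_singleton_eq_top]
    rintro h
    obtain ⟨⟨_, b, rfl⟩, hb⟩ := h.exists_right_inv
    have h1 : Int.castRingHom ℂ (p * b) = Int.castRingHom ℂ 1 := by
      have := congrArg (Subtype.val) hb
      simpa using this
    have h2 : (p : ℤ) ∣ 1 := ⟨b, (hinj h1).symm⟩
    exact hp.one_lt.ne' (by exact_mod_cast Int.eq_one_of_dvd_one (by positivity) h2)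
  obtain ⟨V, -, hV⟩ := Ideal.image_subset_nonunits_valuationSubring _ htop
  refine ⟨V, (V.mem_nonunits_iff).1 (hV ⟨(p : A), Ideal.mem_span_singleton_self _, ?_⟩)⟩
  simp

theorem ValuationSubring.valuation_le_one_of_isIntegral (V : ValuationSubring ℂ) {x : ℂ}
    (hx : IsIntegral ℤ x) : V.valuation x ≤ 1 := by
  rw [V.valuation_le_one_iff]
  have h : IsIntegral V x := hx.tower_top
  obtain ⟨y, rfl⟩ := IsIntegrallyClosed.isIntegral_iff.1 h
  exact y.2

theorem eq_zero_of_eventually_valuation_lt_one {x : ℂ} (hx : IsAlgebraic ℚ x)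
    (h : ∀ᶠ p : ℕ in atTop, p.Prime → ∀ V : ValuationSubring ℂ,
      V.valuation (p : ℂ) < 1 → V.valuation x < 1) : x = 0 := by
  by_contra h0
  have hx' : IsAlgebraic ℤ x⁻¹ := ((IsFractionRing.isAlgebraic_iff ℤ ℚ ℂ).2 hx).inv
  obtain ⟨y, hy0, hy⟩ := hx'.exists_integral_multiple
  obtain ⟨N, hN⟩ := eventually_atTop.1 h
  obtain ⟨p, hpN, hp⟩ := Nat.exists_infinite_primes (max N (y.natAbs + 1))
  obtain ⟨V, hV⟩ := exists_valuationSubring_prime hp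
  have h1 := hN p ((le_max_left _ _).trans hpN) hp V hV
  have h2 := V.valuation_le_one_of_isIntegral hy
  have h3 : V.valuation (y : ℂ) < 1 := by
    have e : (y : ℂ) = x * (y • x⁻¹) := by
      rw [zsmul_eq_mul]
      field_simp
    rw [e, map_mul]
    exact mul_lt_one_of_lt_of_le h1 h2
  have h4 := Int.natAbs_dvd_natAbs.2 (V.valuation.dvd_of_intCast_lt_one hp hV h3)
  have h5 := Nat.le_of_dvd (Int.natAbs_pos.2 hy0) h4
  have h6 := (le_max_right _ _).trans hpN
  rw [Int.natAbs_natCast] at h5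
  omega

theorem expSeries_mem_algebraicCoeffs : expSeries ∈ algebraicCoeffs := fun n => by
  rw [expSeries, coeff_mk]
  have h : (Real.sqrt 3 : ℂ) * Complex.I ∈ algebraicClosure ℚ ℂ := by
    rw [mem_algebraicClosure_iff]
    refine IsAlgebraic.of_pow two_pos ?_
    rw [sqrt_three_mul_I_sq]
    exact isAlgebraic_intCast _
  exact (algebraicClosure ℚ ℂ).div_mem (pow_mem h n) (natCast_mem _ _)

theorem besselSeries_mem_algebraicCoeffs : besselSeries ∈ algebraicCoeffs := fun n => by
  rw [besselSeries, coeff_mk]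
  split_ifs
  · exact (algebraicClosure ℚ ℂ).div_mem (pow_mem (ofNat_mem _ 3) _)
      (mul_mem (pow_mem (ofNat_mem _ 4) _) (pow_mem (natCast_mem _ _) _))
  · exact zero_mem _

theorem coeff_rescale_pow_mul {s : ℂ} (a b : ℕ) (φ ψ : PowerSeries ℂ) (n : ℕ) :
    coeff n (rescale s φ ^ a * rescale s ψ ^ b) = s ^ n * coeff n (φ ^ a * ψ ^ b) := by
  rw [← map_pow, ← map_pow, ← map_mul, coeff_rescale]

theorem rescale_besselSeries {s : ℂ} (hs : s = 1 ∨ s = -1) :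
    rescale s besselSeries = besselSeries := by
  ext n
  rw [coeff_rescale]
  rcases Nat.mod_two_eq_zero_or_one n with h | h
  · rcases hs with rfl | rfl
    · rw [one_pow, one_mul]
    · rw [(Nat.even_iff.2 h).neg_one_pow, one_mul]
  · rw [coeff_besselSeries_of_odd h, mul_zero]

theorem sum_coeff_mul_coeff_eq_zero (r : ℕ) (t : Finset (Fin 2 →₀ ℕ))
    (c : (Fin 2 →₀ ℕ) → PowerSeries ℂ) (hc : ∀ m ∈ t, c m ∈ globallyBounded)
    (h : ∑ m ∈ t, c m * (expSeries ^ m 0 *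
      ((fun F => derivative ℂ F)^[r] besselSeries) ^ m 1) = 0) (n₀ n₁ : ℕ) :
    ∑ m ∈ t, coeff n₀ (c m * (expSeries ^ m 0 *
      ((fun F => derivative ℂ F)^[r] besselSeries) ^ m 1)) *
        coeff n₁ (expSeries ^ m 0 * besselSeries ^ m 1) = 0 := by
  set Br := (fun F => derivative ℂ F)^[r] besselSeries with hBr
  refine eq_zero_of_eventually_valuation_lt_one ?_ ?_
  · rw [← mem_algebraicClosure_iff]
    have hE := expSeries_mem_algebraicCoeffs
    have hB := besselSeries_mem_algebraicCoeffs
    exact sum_mem fun m hm => mul_mem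
      (mul_mem (hc m hm).1 (mul_mem (pow_mem hE _)
        (pow_mem (iterate_derivative_mem_coeffSubring hB r) _)) n₀)
      (mul_mem (pow_mem hE _) (pow_mem hB _) n₁)
  · have hc' : ∀ᶠ p : ℕ in atTop, ∀ m ∈ t, p.Prime → ∀ V : ValuationSubring ℂ,
        V.valuation (p : ℂ) < 1 → c m ∈ coeffSubring V.toSubring :=
      (eventually_all_finset t).2 fun m hm => (hc m hm).2
    filter_upwards [hc', eventually_gt_atTop (n₀ + n₁ + r + 3)] with p hcp hpN hp V hV
    set v := V.valuation with hv
    obtain ⟨s, hs, hE⟩ := exists_dworkLucas_expSeries hp (by omega) hV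
    have hB := dworkLucas_besselSeries hp (by omega) hV
    have hpp : (n₁ + r + 3) * p ≤ p * p := Nat.mul_le_mul_right p (by omega)
    have hpp' : p * n₁ + 3 * p + r * p ≤ p * p := by
      calc _ = (n₁ + r + 3) * p := by ring
        _ ≤ _ := hpp
    have hrp : r ≤ r * p := Nat.le_mul_of_pos_right r hp.pos
    have hBr' : DworkLucas v p (p - r) (p * p - r) Br besselSeries := by
      refine DworkLucas.iterate_derivative hp.pos hV r (by omega) ?_
      rwa [Nat.sub_add_cancel (by omega), Nat.sub_add_cancel (by omega)]
    have hm : ∀ m ∈ t, v ((p : ℂ) ^ n₁ * coeff (p * n₁ + n₀) (c m * (expSeries ^ m 0 * Br ^ m 1))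
        - coeff n₀ (c m * (expSeries ^ m 0 * Br ^ m 1)) *
          (s ^ n₁ * coeff n₁ (expSeries ^ m 0 * besselSeries ^ m 1))) < 1 := by
      intro m hm
      have h1 : DworkLucas v p (p - r) (p * p - r) (c m) 1 :=
        dworkLucas_one_right hV fun n => (V.valuation_le_one_iff _).2 (hcp m hm hp V hV n)
      have h2 := h1.mul hp.pos hV (((hE.mono (Nat.sub_le _ _) (Nat.sub_le _ _)).pow hp.pos hV
        (m 0)).mul hp.pos hV (hBr'.pow hp.pos hV (m 1)))
      have h3 := h2.sub_lt_one (p * n₁ + n₀) (by omega) (by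
        rw [Nat.mul_add_mod, Nat.mod_eq_of_lt] <;> omega)
      rw [Nat.mul_add_mod, Nat.mod_eq_of_lt (by omega), Nat.mul_add_div hp.pos,
        Nat.div_eq_of_lt (by omega), add_zero, one_mul] at h3
      rw [← rescale_besselSeries hs, coeff_rescale_pow_mul] at h3
      exact h3
    have h1 := v.map_sum_lt one_ne_zero hm
    rw [Finset.sum_sub_distrib, ← Finset.mul_sum, ← map_sum, h, map_zero, mul_zero, zero_sub,
      v.map_neg] at h1
    have hvs : v s = 1 := by rcases hs with rfl | rfl <;> simp
    simp only [mul_left_comm _ (s ^ n₁)] at h1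
    rwa [← Finset.mul_sum, map_mul, map_pow, hvs, one_pow, one_mul] at h1

theorem expSeries_ne_zero : expSeries ≠ 0 := fun h => by
  have := congrArg (coeff 0) h
  simp [expSeries] at this

theorem iterate_derivative_besselSeries_ne_zero (r : ℕ) :
    (fun F => derivative ℂ F)^[r] besselSeries ≠ 0 := fun h => by
  have h1 := congrArg (coeff r) h
  rw [coeff_iterate_derivative, map_zero] at h1
  have h2 : coeff (r + r) besselSeries ≠ 0 := by
    rw [← two_mul, coeff_two_mul_besselSeries]
    have : (r.factorial : ℂ) ≠ 0 := by exact_mod_cast Nat.factorial_ne_zero r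
    exact mul_ne_zero (pow_ne_zero _ (by norm_num)) (inv_ne_zero (pow_ne_zero _ this))
  refine mul_ne_zero ?_ h2 h1
  exact_mod_cast (Nat.ascFactorial_pos r r).ne'

theorem exp_bessel_no_relation_globallyBounded (r : ℕ) (t : Finset (Fin 2 →₀ ℕ))
    (c : (Fin 2 →₀ ℕ) → PowerSeries ℂ) (hc : ∀ m ∈ t, c m ∈ globallyBounded)
    (h : ∑ m ∈ t, c m * (expSeries ^ m 0 *
      ((fun F => derivative ℂ F)^[r] besselSeries) ^ m 1) = 0) : ∀ m ∈ t, c m = 0 := by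
  intro m hm
  have h1 : c m * (expSeries ^ m 0 * ((fun F => derivative ℂ F)^[r] besselSeries) ^ m 1) = 0 := by
    refine PowerSeries.ext fun n₀ => ?_
    rw [(coeff n₀).map_zero]
    refine exp_bessel_no_relation t (fun m => coeff n₀ (c m * (expSeries ^ m 0 *
      ((fun F => derivative ℂ F)^[r] besselSeries) ^ m 1))) ?_ m hm
    refine PowerSeries.ext fun n₁ => ?_
    rw [map_sum, map_zero, ← sum_coeff_mul_coeff_eq_zero r t c hc h n₀ n₁]
    exact Finset.sum_congr rfl fun m _ => coeff_C_mul _ _ _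
  exact (mul_eq_zero.1 h1).resolve_right (mul_ne_zero (pow_ne_zero _ expSeries_ne_zero)
    (pow_ne_zero _ (iterate_derivative_besselSeries_ne_zero r)))

end GloballyBounded

section Assembly

open PowerSeries Filter

theorem aeval_pair {R A : Type*} [CommRing R] [CommRing A] [Algebra R A] (y₀ y₁ : A)
    (q : MvPolynomial (Fin 2) R) :
    MvPolynomial.aeval ![y₀, y₁] q
      = ∑ m ∈ q.support, algebraMap R A (q.coeff m) * (y₀ ^ m 0 * y₁ ^ m 1) := by
  rw [MvPolynomial.aeval_def, MvPolynomial.eval₂_eq']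
  simp

theorem coeff_aperySeries {R : Type*} [CommRing R] (n : ℕ) :
    coeff n (aperySeries R) = (aperyNumber n : R) := coeff_mk _ _

theorem aperySeries_mem_globallyBounded : aperySeries ℂ ∈ globallyBounded := by
  refine ⟨fun n => ?_, Eventually.of_forall fun p _ V _ n => ?_⟩ <;> rw [coeff_aperySeries]
  · exact natCast_mem _ _
  · exact natCast_mem V.toSubring _

theorem hypergeometricSeries_mem_globallyBounded :
    hypergeometricSeries (2⁻¹ : ℂ) ∈ globallyBounded := by
  have h : ∀ A : Subring ℂ, (2⁻¹ : ℂ) ∈ A → hypergeometricSeries (2⁻¹ : ℂ) ∈ coeffSubring A := by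
    intro A hA n
    rw [hypergeometricSeries, coeff_mk]
    exact A.mul_mem (A.neg_mem (A.mul_mem (pow_mem (natCast_mem A _) _) (intCast_mem A _)))
      (pow_mem hA _)
  refine ⟨h _ ((algebraicClosure ℚ ℂ).inv_mem (ofNat_mem _ 2)), ?_⟩
  filter_upwards [eventually_gt_atTop 2] with p hp2 hp V hV
  refine h _ ((V.valuation_le_one_iff _).1 ?_)
  have h2 := V.valuation.intCast_eq_one hp hV (n := 2) fun h => by
    have := Int.le_of_dvd (by norm_num) h
    omega
  rw [Int.cast_ofNat] at h2
  rw [map_inv₀, h2, inv_one]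

theorem X_mem_globallyBounded : (X : PowerSeries ℂ) ∈ globallyBounded := by
  have h : ∀ A : Subring ℂ, (X : PowerSeries ℂ) ∈ coeffSubring A := fun A n => by
    rw [coeff_X]
    split_ifs
    exacts [A.one_mem, A.zero_mem]
  exact ⟨h _, Eventually.of_forall fun _ _ _ _ => h _⟩

theorem aeval_X_eq_coe_map (q : Polynomial ℤ) : Polynomial.aeval (X : PowerSeries ℂ) q
    = ((q.map (Int.castRingHom ℂ) : Polynomial ℂ) : PowerSeries ℂ) := by
  have h : (Polynomial.aeval (X : PowerSeries ℂ) : Polynomial ℤ →ₐ[ℤ] PowerSeries ℂ).toRingHom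
      = (Polynomial.coeToPowerSeries.ringHom (R := ℂ)).comp
        (Polynomial.mapRingHom (Int.castRingHom ℂ)) := by
    refine Polynomial.ringHom_ext' (Subsingleton.elim _ _) ?_
    simp
  exact RingHom.congr_fun h q

theorem algebraicIndependent_X :
    AlgebraicIndependent ℤ (fun _ : Unit => (X : PowerSeries ℂ)) := by
  rw [algebraicIndependent_unique_type_iff, transcendental_iff]
  intro q hq
  rw [aeval_X_eq_coe_map, Polynomial.coe_eq_zero_iff] at hq
  exact (Polynomial.map_eq_zero_iff (Int.castRingHom ℂ).injective_int).1 hq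

theorem algebraicIndependent_apery_hypergeometric (s k : ℕ) :
    AlgebraicIndependent (Algebra.adjoin ℤ (Set.range fun _ : Unit => (X : PowerSeries ℂ)))
      ![(fun F => derivative ℂ F)^[s] (aperySeries ℂ),
        (fun F => derivative ℂ F)^[k] (hypergeometricSeries (2⁻¹ : ℂ))] := by
  rw [algebraicIndependent_iff]
  intro P hP
  have hq : ∀ c : Algebra.adjoin ℤ (Set.range fun _ : Unit => (X : PowerSeries ℂ)),
      ∃ q : Polynomial ℤ, ((q.map (Int.castRingHom ℂ) : Polynomial ℂ) : PowerSeries ℂ) = c := by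
    rintro ⟨c, hc⟩
    rw [Set.range_const, Algebra.adjoin_singleton_eq_range_aeval] at hc
    obtain ⟨q, rfl⟩ := hc
    exact ⟨q, (aeval_X_eq_coe_map q).symm⟩
  choose q hq using hq
  by_contra h0
  refine no_relation_reduction s k P.support (fun m => q (P.coeff m)) ?_ ?_
  · obtain ⟨m, hm⟩ := Finset.nonempty_iff_ne_empty.2 (mt MvPolynomial.support_eq_empty.1 h0)
    refine ⟨m, hm, fun h => MvPolynomial.mem_support_iff.1 hm (Subtype.ext ?_)⟩
    rw [← hq, h]
    simp
  · rw [aeval_pair] at hP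
    rw [← hP]
    exact Finset.sum_congr rfl fun m _ => by rw [hq]; rfl

theorem algebraicIndependent_exp_bessel (r : ℕ) (S : Subalgebra ℤ (PowerSeries ℂ))
    (hS : ∀ c ∈ S, c ∈ globallyBounded) :
    AlgebraicIndependent S ![expSeries, (fun F => derivative ℂ F)^[r] besselSeries] := by
  rw [algebraicIndependent_iff]
  intro P hP
  rw [aeval_pair] at hP
  have h := exp_bessel_no_relation_globallyBounded r P.support 
    (fun m => (MvPolynomial.coeff m P).1) (fun m _ => hS _ (MvPolynomial.coeff m P).2) hP
  ext m
  by_cases hm : m ∈ P.support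
  · rw [h m hm]
    rfl
  · rw [MvPolynomial.notMem_support_iff.1 hm]
    rfl

theorem adjoin_le_globallyBounded {ι : Type*} {x : ι → PowerSeries ℂ}
    (hx : ∀ i, x i ∈ globallyBounded) {c : PowerSeries ℂ}
    (hc : c ∈ Algebra.adjoin ℤ (Set.range x)) : c ∈ globallyBounded := by
  induction hc using Algebra.adjoin_induction with
  | mem _ h =>
    obtain ⟨i, rfl⟩ := h
    exact hx i
  | algebraMap n =>
    rw [eq_intCast]
    exact intCast_mem _ n
  | add _ _ _ _ h₁ h₂ => exact add_mem h₁ h₂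
  | mul _ _ _ _ h₁ h₂ => exact mul_mem h₁ h₂

theorem besselSeries_eq : besselSeries = mk fun m : ℕ => if m % 2 = 0 then
    (3 : ℂ) ^ (m / 2) / (4 ^ (m / 2) * (((m / 2).factorial : ℂ)) ^ 2) else 0 := rfl

theorem aperySeries_eq : aperySeries ℂ = mk fun n : ℕ => ∑ j ∈ Finset.range (n + 1),
    ((n.choose j : ℂ)) ^ 2 * (((n + j).choose j : ℂ)) ^ 2 := by
  ext n
  rw [coeff_aperySeries, coeff_mk, aperyNumber]
  push_cast
  rfl

theorem hypergeometricSeries_eq : hypergeometricSeries (2⁻¹ : ℂ) = mk fun n : ℕ =>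
    -(((2 * n).choose n : ℂ)) ^ 3 / ((2 * (n : ℂ) - 1) * 64 ^ n) := by
  ext n
  rw [hypergeometricSeries, coeff_mk, coeff_mk, ← Nat.centralBinom_eq_two_mul_choose]
  have h := congrArg (Int.cast (R := ℂ)) (centralBinomQuotient_mul n)
  push_cast at h
  have h1 : (2 * (n : ℂ) - 1) ≠ 0 := by
    have : (2 * (n : ℤ) - 1) ≠ 0 := by omega
    exact_mod_cast this
  have h2 : (2⁻¹ : ℂ) ^ (6 * n) = (64 ^ n)⁻¹ := by
    rw [pow_mul, ← inv_pow]
    norm_num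
  rw [h2]
  field_simp
  rw [← h]
  ring

end Assembly

/-- **Corollary 6.3.** With `π₃ = √3·i`, the formal power series `z`, `exp(π₃z)`,
`J₀⁽ʳ⁾(π₃z)`, `𝔄⁽ˢ⁾(z)` (Apéry) and `𝔣⁽ᵏ⁾(z)` (the ₃F₂((-1/2,1/2,1/2),(1,1);z) series)
are algebraically independent over `ℚ`; equivalently `exp(π₃z)`, `J₀⁽ʳ⁾(π₃z)`,
`𝔄⁽ˢ⁾(z)`, `𝔣⁽ᵏ⁾(z)` are algebraically independent over `ℚ(z)`. -/
theorem stmt13 (r s k : ℕ) :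
    AlgebraicIndependent ℚ
      ![(PowerSeries.X : PowerSeries ℂ),
        PowerSeries.mk (fun n : ℕ =>
          ((Real.sqrt 3 : ℂ) * Complex.I) ^ n / (n.factorial : ℂ)),
        (fun F => PowerSeries.derivative ℂ F)^[r]
          (PowerSeries.mk (fun m : ℕ => if m % 2 = 0 then
            (3 : ℂ) ^ (m / 2) / (4 ^ (m / 2) * (((m / 2).factorial : ℂ)) ^ 2) else 0)),
        (fun F => PowerSeries.derivative ℂ F)^[s]
          (PowerSeries.mk (fun n : ℕ => ((∑ j ∈ Finset.range (n + 1),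
            ((n.choose j : ℂ)) ^ 2 * (((n + j).choose j : ℂ)) ^ 2)))),
        (fun F => PowerSeries.derivative ℂ F)^[k]
          (PowerSeries.mk (fun n : ℕ =>
            -(((2 * n).choose n : ℂ)) ^ 3 / ((2 * (n : ℂ) - 1) * 64 ^ n)))] := by
  rw [← besselSeries_eq, ← aperySeries_eq, ← hypergeometricSeries_eq]
  have h3 := algebraicIndependent_X.sumElim (algebraicIndependent_apery_hypergeometric s k)
  have h5 := h3.sumElim (algebraicIndependent_exp_bessel r _ fun c hc =>
    adjoin_le_globallyBounded (by
      rintro (i | i)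
      · fin_cases i
        · exact iterate_derivative_mem_globallyBounded aperySeries_mem_globallyBounded s
        · exact iterate_derivative_mem_globallyBounded hypergeometricSeries_mem_globallyBounded k
      · exact X_mem_globallyBounded) hc)
  have h := h5.comp ![Sum.inr (Sum.inr ()), Sum.inl 0, Sum.inl 1, Sum.inr (Sum.inl 0),
    Sum.inr (Sum.inl 1)] (by decide)
  have : Algebra.IsAlgebraic ℤ ℚ := IsLocalization.isAlgebraic ℚ (nonZeroDivisors ℤ)
  convert h.extendScalars ℚ using 1
  ext1 i
  fin_cases i <;> rfl
end
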